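/- arXiv:2312.15294 — 3 statements merged into one kernel-verified Lean document; each statement's English description precedes it below -/
import Mathlib

section
/- Let ρ be a real-valued radial neutral Schwartz function on ℝ², let m > 0, I > 0, let v ∈ ℝ² with |v| < 1 and ω ∈ ℝ, and set P = P^{rel}_{v,ω} := mv/√(1−|v|²) − ⟨Π_{v,ω},∇_*A_{v,ω}⟩ + ⟨A_{v,ω},ρ⟩ and M = M_{v,ω}. Then for all Schwartz vector fields a, π : ℝ² → ℝ² with div a = 0 and div π = 0, one has H^{rel}_{P,M}(A_{v,ω}+a, Π_{v,ω}+π) − H^{rel}_{P,M}(A_{v,ω}, Π_{v,ω}) ≥ ((1−|v|)/2)·(∫_{ℝ²}|∇a|² dy + ∫_{ℝ²}|π|² dy). (Orbital stability lower bound for the relativistic particle.) -/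
open MeasureTheory
open scoped RealInnerProductSpace BigOperators

noncomputable section

abbrev V2 : Type := EuclideanSpace ℝ (Fin 2)

/-- standard basis vector of ℝ² -/
def e2 (j : Fin 2) : V2 := EuclideanSpace.single j 1

/-- Fourier transform with normalization `(2π)⁻¹ ∫ e^{-ik·x} ρ(x) dx`. -/
def FT (ρ : V2 → ℝ) (k : V2) : ℂ :=
  ((2 * Real.pi : ℝ) : ℂ)⁻¹ * ∫ x : V2, Complex.exp (-Complex.I * ((⟪k, x⟫ : ℝ) : ℂ)) * (ρ x : ℂ)

/-- j-th partial derivative of a complex-valued function on ℝ². -/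
def pd (f : V2 → ℂ) (j : Fin 2) (k : V2) : ℂ := fderiv ℝ f k (e2 j)

/-- `|∇f(k)|²` for a complex-valued function on ℝ². -/
def gradNormSqC (f : V2 → ℂ) (k : V2) : ℝ := ∑ j, ‖pd f j k‖ ^ 2

/-- `D(k) = |k|² - (v·k)²`. -/
def Dv (v : V2) (k : V2) : ℝ := ‖k‖ ^ 2 - (⟪v, k⟫ : ℝ) ^ 2

/-- `(J ∇f)_j` where `J` has rows `(0,1)`, `(-1,0)`. -/
def Jgrad (f : V2 → ℂ) (j : Fin 2) (k : V2) : ℂ := ![pd f 1 k, -pd f 0 k] j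

/-- Fourier transform of the soliton field `A_{v,ω}`. -/
def Ahat (ρ : V2 → ℝ) (v : V2) (ω : ℝ) (j : Fin 2) (k : V2) : ℂ :=
  (((v j - k j * (⟪v, k⟫ : ℝ) / ‖k‖ ^ 2 : ℝ) : ℂ) * FT ρ k
      - Complex.I * (ω : ℂ) * Jgrad (FT ρ) j k) / ((Dv v k : ℝ) : ℂ)

/-- The soliton field `A_{v,ω}` (inverse Fourier transform of `Ahat`). -/
def Asol (ρ : V2 → ℝ) (v : V2) (ω : ℝ) (j : Fin 2) (y : V2) : ℝ :=
  (((2 * Real.pi : ℝ) : ℂ)⁻¹ *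
    ∫ k : V2, Complex.exp (Complex.I * ((⟪k, y⟫ : ℝ) : ℂ)) * Ahat ρ v ω j k).re

/-- The soliton field `Π_{v,ω} = -(v·∇) A_{v,ω}`. -/
def Pisol (ρ : V2 → ℝ) (v : V2) (ω : ℝ) (j : Fin 2) (y : V2) : ℝ :=
  - fderiv ℝ (Asol ρ v ω j) y v

/-- `|∇A(y)|² = ∑_{i,j} (∂_i A_j(y))²`. -/
def gradSq (A : Fin 2 → V2 → ℝ) (y : V2) : ℝ :=
  ∑ i, ∑ j, (fderiv ℝ (A j) y (e2 i)) ^ 2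

/-- Field energy `½∫ (|Π|² + |∇A|²)`. -/
def fieldEnergy (A Pf : Fin 2 → V2 → ℝ) : ℝ :=
  (1 / 2) * ∫ y : V2, ((∑ j, (Pf j y) ^ 2) + gradSq A y)

/-- `⟨Π, ∇_* A⟩_j = ∫ Π(y)·∂_j A(y) dy`. -/
def momTerm (A Pf : Fin 2 → V2 → ℝ) (j : Fin 2) : ℝ :=
  ∫ y : V2, ∑ l, Pf l y * fderiv ℝ (A l) y (e2 j)

/-- `⟨A, ρ⟩_j = ∫ A_j(y) ρ(y) dy`. -/
def chargeTerm (ρ : V2 → ℝ) (A : Fin 2 → V2 → ℝ) (j : Fin 2) : ℝ :=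
  ∫ y : V2, A j y * ρ y

/-- `∫ (Jy)·A(y) ρ(y) dy` where `(Jy) = (y₂, -y₁)`. -/
def angTerm (ρ : V2 → ℝ) (A : Fin 2 → V2 → ℝ) : ℝ :=
  ∫ y : V2, (y 1 * A 0 y - y 0 * A 1 y) * ρ y

/-- The reduced Hamiltonian `H_{P,M}(A,Π)`. -/
def Hred (m I : ℝ) (ρ : V2 → ℝ) (P : Fin 2 → ℝ) (M : ℝ) (A Pf : Fin 2 → V2 → ℝ) : ℝ :=
  fieldEnergy A Pf
    + (1 / (2 * m)) * ∑ j, (P j + momTerm A Pf j - chargeTerm ρ A j) ^ 2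
    + (1 / (2 * I)) * (M + angTerm ρ A) ^ 2

/-- The soliton linear momentum `P_{v,ω}`. -/
def Psol (ρ : V2 → ℝ) (m : ℝ) (v : V2) (ω : ℝ) (j : Fin 2) : ℝ :=
  m * v j - momTerm (Asol ρ v ω) (Pisol ρ v ω) j + chargeTerm ρ (Asol ρ v ω) j

/-- The soliton angular momentum `M_{v,ω}`. -/
def Msol (ρ : V2 → ℝ) (I : ℝ) (v : V2) (ω : ℝ) : ℝ :=
  I * ω - angTerm ρ (Asol ρ v ω)

/-- The relativistic reduced Hamiltonian `H^{rel}_{P,M}(A,Π)`. -/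
def Hrel (m I : ℝ) (ρ : V2 → ℝ) (P : Fin 2 → ℝ) (M : ℝ) (A Pf : Fin 2 → V2 → ℝ) : ℝ :=
  fieldEnergy A Pf
    + Real.sqrt (m ^ 2 + ∑ j, (P j + momTerm A Pf j - chargeTerm ρ A j) ^ 2)
    + (1 / (2 * I)) * (M + angTerm ρ A) ^ 2

/-- The relativistic soliton linear momentum `P^{rel}_{v,ω}`. -/
def Prel (ρ : V2 → ℝ) (m : ℝ) (v : V2) (ω : ℝ) (j : Fin 2) : ℝ :=
  m * v j / Real.sqrt (1 - ‖v‖ ^ 2)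
    - momTerm (Asol ρ v ω) (Pisol ρ v ω) j + chargeTerm ρ (Asol ρ v ω) j

section SolitonLemmas

open scoped FourierTransform LineDeriv SchwartzMap

section L2

theorem integral_fourierInv_mul {f : V2 → ℂ} (hf : Integrable f) (φ : 𝓢(V2, ℂ)) :
    ∫ y, 𝓕⁻ f y * φ y = ∫ ξ, f ξ * 𝓕⁻ φ ξ := by
  have h := VectorFourier.integral_fourierIntegral_smul_eq_flip (𝕜 := ℝ) (μ := volume)
    (ν := volume) (L := -innerₗ V2)
    Real.continuous_fourierChar
    (by simp only [LinearMap.neg_apply, innerₗ_apply_apply]; fun_prop) hf φ.integrable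
  rw [SchwartzMap.fourierInv_coe]
  convert! h using 4
  rw [show (-innerₗ V2).flip = -innerₗ V2 by ext; simp [real_inner_comm]]
  rfl

open scoped ContDiff in
theorem memLp_two_fourierInv {f : V2 → ℂ} (hf : Integrable f) (hf2 : MemLp f 2) :
    MemLp (𝓕⁻ f) 2 := by
  set G : Lp ℂ 2 (volume : Measure V2) := 𝓕⁻ (hf2.toLp f) with hG
  have hc : Continuous (𝓕⁻ f) :=
    VectorFourier.fourierIntegral_continuous Real.continuous_fourierChar
      (by simp only [LinearMap.neg_apply, innerₗ_apply_apply]; fun_prop) hf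
  have key : (G : V2 → ℂ) =ᵐ[volume] 𝓕⁻ f := by
    refine ae_eq_of_integral_contDiff_smul_eq ((Lp.memLp G).locallyIntegrable (by norm_num))
      hc.locallyIntegrable fun g hg hgs => ?_
    have hs : HasCompactSupport (fun x => (g x : ℂ)) :=
      hgs.comp_left (g := Complex.ofReal) Complex.ofReal_zero
    have hd : ContDiff ℝ ∞ (fun x => (g x : ℂ)) := Complex.ofRealCLM.contDiff.comp hg
    have e1 := congrArg (fun T : TemperedDistribution V2 ℂ => T (hs.toSchwartzMap hd))
      (Lp.fourierInv_toTemperedDistribution_eq (hf2.toLp f))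
    simp only [TemperedDistribution.fourierInv_apply, Lp.toTemperedDistribution_apply] at e1
    have e2 := integral_fourierInv_mul hf (hs.toSchwartzMap hd)
    have e3 : ∫ x, (𝓕⁻ (hs.toSchwartzMap hd)) x • (hf2.toLp f) x
        = ∫ ξ, f ξ * 𝓕⁻ (hs.toSchwartzMap hd) ξ := by
      refine integral_congr_ae ?_
      filter_upwards [hf2.coeFn_toLp] with x hx
      rw [hx, smul_eq_mul, mul_comm]
    rw [e3, ← e2] at e1
    simpa [mul_comm] using e1.symm
  exact (memLp_congr_ae key).1 (Lp.memLp G)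

end L2

section FourierInversionField

theorem integrable_inner_smul {B : V2 → ℂ} (h0 : AEStronglyMeasurable B)
    (h1 : Integrable fun ξ => ‖ξ‖ * ‖B ξ‖) (w : V2) :
    Integrable fun ξ => 2 * Real.pi * Complex.I * (⟪ξ, w⟫ : ℝ) * B ξ := by
  refine (h1.const_mul (2 * Real.pi * ‖w‖)).mono' (by fun_prop) (.of_forall fun ξ => ?_)
  have := norm_inner_le_norm (𝕜 := ℝ) ξ w
  simp only [norm_mul, Complex.norm_real, Complex.norm_I, Complex.norm_ofNat, mul_one]
  rw [Real.norm_of_nonneg Real.pi_pos.le]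
  calc 2 * Real.pi * ‖(⟪ξ, w⟫ : ℝ)‖ * ‖B ξ‖ ≤ 2 * Real.pi * (‖ξ‖ * ‖w‖) * ‖B ξ‖ := by gcongr
    _ = _ := by ring

theorem memLp_inner_smul {B : V2 → ℂ} (h0 : AEStronglyMeasurable B)
    (h2 : MemLp (fun ξ => ‖ξ‖ * ‖B ξ‖) 2) (w : V2) :
    MemLp (fun ξ => 2 * Real.pi * Complex.I * (⟪ξ, w⟫ : ℝ) * B ξ) 2 := by
  refine (h2.const_mul (2 * Real.pi * ‖w‖)).mono (by fun_prop) (.of_forall fun ξ => ?_)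
  have := norm_inner_le_norm (𝕜 := ℝ) ξ w
  simp only [norm_mul, Complex.norm_real, Complex.norm_I, Complex.norm_ofNat, mul_one, norm_norm]
  rw [Real.norm_of_nonneg Real.pi_pos.le, Real.norm_of_nonneg zero_le_two]
  calc 2 * Real.pi * ‖(⟪ξ, w⟫ : ℝ)‖ * ‖B ξ‖ ≤ 2 * Real.pi * (‖ξ‖ * ‖w‖) * ‖B ξ‖ := by gcongr
    _ = _ := by ring

theorem hasFDerivAt_fourierInv {B : V2 → ℂ} (h0 : Integrable B)
    (h1 : Integrable fun ξ => ‖ξ‖ * ‖B ξ‖) (y : V2) :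
    ∃ L : V2 →L[ℝ] ℂ, HasFDerivAt (𝓕⁻ B) L y ∧
      ∀ w, L w = 𝓕⁻ (fun ξ => 2 * Real.pi * Complex.I * (⟪ξ, w⟫ : ℝ) * B ξ) y := by
  refine ⟨_, VectorFourier.hasFDerivAt_fourierIntegral (-innerSL ℝ) h0 h1 y, fun w => ?_⟩
  have hi : Integrable (VectorFourier.fourierSMulRight (-innerSL ℝ) B) := by
    refine (h1.const_mul (2 * Real.pi * ‖(-innerSL ℝ : V2 →L[ℝ] V2 →L[ℝ] ℝ)‖)).mono'
      h0.1.fourierSMulRight (.of_forall fun ξ => ?_)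
    exact (VectorFourier.norm_fourierSMulRight_le _ B ξ).trans_eq (by ring)
  rw [Real.fourierIntegral_continuousLinearMap_apply' hi]
  change _ = VectorFourier.fourierIntegral _ _ (-innerₗ V2) _ _
  congr 1
  ext ξ
  simp [mul_assoc, innerSL_apply_apply ℝ]

theorem hasFDerivAt_re_fourierInv {B : V2 → ℂ} (h0 : Integrable B)
    (h1 : Integrable fun ξ => ‖ξ‖ * ‖B ξ‖) (y : V2) :
    ∃ L : V2 →L[ℝ] ℝ, HasFDerivAt (fun y => (𝓕⁻ B y).re) L y ∧
      ∀ w, L w = (𝓕⁻ (fun ξ => 2 * Real.pi * Complex.I * (⟪ξ, w⟫ : ℝ) * B ξ) y).re := by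
  obtain ⟨L, hL, hw⟩ := hasFDerivAt_fourierInv h0 h1 y
  exact ⟨Complex.reCLM.comp L, Complex.reCLM.hasFDerivAt.comp y hL, fun w => by simp [hw]⟩

theorem differentiable_re_fourierInv {B : V2 → ℂ} (h0 : Integrable B)
    (h1 : Integrable fun ξ => ‖ξ‖ * ‖B ξ‖) : Differentiable ℝ (fun y => (𝓕⁻ B y).re) :=
  fun y => let ⟨_, hL, _⟩ := hasFDerivAt_re_fourierInv h0 h1 y; hL.differentiableAt

theorem fderiv_re_fourierInv {B : V2 → ℂ} (h0 : Integrable B)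
    (h1 : Integrable fun ξ => ‖ξ‖ * ‖B ξ‖) (y w : V2) :
    fderiv ℝ (fun y => (𝓕⁻ B y).re) y w =
      (𝓕⁻ (fun ξ => 2 * Real.pi * Complex.I * (⟪ξ, w⟫ : ℝ) * B ξ) y).re := by
  obtain ⟨L, hL, hw⟩ := hasFDerivAt_re_fourierInv h0 h1 y
  rw [hL.fderiv, hw]

theorem memLp_fderiv_re_fourierInv {B : V2 → ℂ} (h0 : Integrable B)
    (h1 : Integrable fun ξ => ‖ξ‖ * ‖B ξ‖) (h2 : MemLp (fun ξ => ‖ξ‖ * ‖B ξ‖) 2) (w : V2) :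
    MemLp (fun y => fderiv ℝ (fun y => (𝓕⁻ B y).re) y w) 2 := by
  simp_rw [fderiv_re_fourierInv h0 h1]
  exact (memLp_two_fourierInv (integrable_inner_smul h0.1 h1 w) (memLp_inner_smul h0.1 h2 w)).re

theorem abs_re_fourierInv_le (B : V2 → ℂ) (y : V2) : |(𝓕⁻ B y).re| ≤ ∫ ξ, ‖B ξ‖ :=
  (Complex.abs_re_le_norm _).trans
    (VectorFourier.norm_fourierIntegral_le_integral_norm _ _ _ _ _)

/-- The complexification of a real Schwartz function. -/
def toC (φ : 𝓢(V2, ℝ)) : 𝓢(V2, ℂ) := φ.postcompCLM Complex.ofRealCLM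

@[simp] theorem toC_apply (φ : 𝓢(V2, ℝ)) (x : V2) : toC φ x = φ x := rfl

theorem integral_re_fourierInv_mul {B : V2 → ℂ} (h0 : Integrable B) (φ : 𝓢(V2, ℝ)) :
    ∫ y, (𝓕⁻ B y).re * φ y = (∫ ξ, B ξ * 𝓕⁻ (toC φ) ξ).re := by
  have hc : Continuous (𝓕⁻ B) :=
    VectorFourier.fourierIntegral_continuous Real.continuous_fourierChar
      (by simp only [LinearMap.neg_apply, innerₗ_apply_apply]; fun_prop) h0
  have hint : Integrable fun y => 𝓕⁻ B y * toC φ y :=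
    (toC φ).integrable.bdd_mul hc.aestronglyMeasurable (c := ∫ ξ, ‖B ξ‖)
      (.of_forall fun y => VectorFourier.norm_fourierIntegral_le_integral_norm _ _ _ _ _)
  rw [← integral_fourierInv_mul h0, ← RCLike.re_eq_complex_re, ← integral_re hint]
  simp

theorem toC_lineDeriv (φ : 𝓢(V2, ℝ)) (w : V2) : toC (∂_{w} φ) = ∂_{w} (toC φ) := by
  ext x
  rw [SchwartzMap.lineDerivOp_apply_eq_fderiv, toC_apply, SchwartzMap.lineDerivOp_apply_eq_fderiv]
  have h := (Complex.ofRealCLM.hasFDerivAt.comp x (φ.differentiable x).hasFDerivAt).fderiv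
  exact (congrArg (fun L => L w) h).symm

theorem fourierInv_toC_lineDeriv (φ : 𝓢(V2, ℝ)) (w ξ : V2) :
    𝓕⁻ (toC (∂_{w} φ)) ξ = -(2 * Real.pi * Complex.I) * (⟪ξ, w⟫ : ℝ) * 𝓕⁻ (toC φ) ξ := by
  have : (inner ℝ · w).HasTemperateGrowth := ((innerSL ℝ).flip w).hasTemperateGrowth
  rw [toC_lineDeriv, SchwartzMap.fourierInv_lineDerivOp_eq]
  simp [this, mul_assoc]

theorem integral_fderiv_mul_fderiv {B : V2 → ℂ} (h0 : Integrable B)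
    (h1 : Integrable fun ξ => ‖ξ‖ * ‖B ξ‖) (φ : 𝓢(V2, ℝ)) (w : V2) :
    ∫ y, fderiv ℝ (fun y => (𝓕⁻ B y).re) y w * fderiv ℝ φ y w =
      (∫ ξ, ((2 * Real.pi) ^ 2 * (⟪ξ, w⟫ : ℝ) ^ 2 : ℝ) * B ξ * 𝓕⁻ (toC φ) ξ).re := by
  simp_rw [fderiv_re_fourierInv h0 h1, ← SchwartzMap.lineDerivOp_apply_eq_fderiv]
  rw [integral_re_fourierInv_mul (integrable_inner_smul h0.1 h1 w)]
  simp_rw [fourierInv_toC_lineDeriv]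
  congr 2
  ext ξ
  push_cast
  linear_combination (-(2 * Real.pi : ℂ) ^ 2 * (⟪ξ, w⟫ : ℝ) ^ 2 * B ξ * 𝓕⁻ (toC φ) ξ) * Complex.I_sq

theorem integrable_weighted_mul {B : V2 → ℂ} (h0 : AEStronglyMeasurable B)
    (h1 : Integrable fun ξ => ‖ξ‖ * ‖B ξ‖) (φ : 𝓢(V2, ℂ)) (w : V2) :
    Integrable fun ξ => ((2 * Real.pi) ^ 2 * (⟪ξ, w⟫ : ℝ) ^ 2 : ℝ) * B ξ * φ ξ := by
  have hg : (inner ℝ · w).HasTemperateGrowth := ((innerSL ℝ).flip w).hasTemperateGrowth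
  set ψ := SchwartzMap.smulLeftCLM ℂ (inner ℝ · w) φ
  have := (integrable_inner_smul h0 h1 w).mul_bdd (c := ‖ψ.toBoundedContinuousFunction‖)
    ψ.continuous.aestronglyMeasurable
    (.of_forall fun x => ψ.toBoundedContinuousFunction.norm_coe_le_norm x)
  refine (this.const_mul (-(2 * Real.pi * Complex.I))).congr (.of_forall fun ξ => ?_)
  simp only [ψ, SchwartzMap.smulLeftCLM_apply_apply hg, Complex.real_smul]
  push_cast
  linear_combination (-(2 * Real.pi : ℂ) ^ 2 * (⟪ξ, w⟫ : ℝ) ^ 2 * B ξ * φ ξ) * Complex.I_sq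

end FourierInversionField

section Decay

theorem schwartz_norm_mul_le {S : 𝓢(V2, ℂ)} (hS : S 0 = 0) :
    ∃ C, 0 ≤ C ∧ ∀ ξ, ‖S ξ‖ * (1 + ‖ξ‖) ^ 4 ≤ C * ‖ξ‖ := by
  obtain ⟨C₁, hC₁, h₁⟩ := S.decay 0 1
  obtain ⟨C₂, hC₂, h₂⟩ := S.decay 4 0
  have hlip : ∀ ξ, ‖S ξ‖ ≤ C₁ * ‖ξ‖ := fun ξ => by
    have := (convex_univ (𝕜 := ℝ) (E := V2)).norm_image_sub_le_of_norm_fderiv_le (f := S) (C := C₁)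
      (fun x _ => S.differentiableAt) (fun x _ => by simpa [norm_iteratedFDeriv_one] using h₁ x)
      (Set.mem_univ 0) (Set.mem_univ ξ)
    simpa [hS] using this
  refine ⟨16 * C₁ + 16 * C₂, by positivity, fun ξ => ?_⟩
  have hn := norm_nonneg ξ
  rcases le_total ‖ξ‖ 1 with h | h
  · calc ‖S ξ‖ * (1 + ‖ξ‖) ^ 4 ≤ (C₁ * ‖ξ‖) * (1 + 1) ^ 4 := by gcongr; exact hlip ξ
      _ ≤ _ := by nlinarith [mul_nonneg hC₂.le hn]
  · calc ‖S ξ‖ * (1 + ‖ξ‖) ^ 4 ≤ ‖S ξ‖ * (‖ξ‖ + ‖ξ‖) ^ 4 := by gcongr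
      _ = 16 * (‖ξ‖ ^ 4 * ‖S ξ‖) := by ring
      _ ≤ 16 * C₂ := by gcongr; simpa using h₂ ξ
      _ ≤ _ := by nlinarith [mul_nonneg hC₁.le hn]

theorem integrable_of_norm_le {B : V2 → ℂ} (hm : AEStronglyMeasurable B) {C : ℝ}
    (hB : ∀ ξ, ‖B ξ‖ ≤ C * (‖ξ‖⁻¹ * ((1 + ‖ξ‖) ^ 4)⁻¹)) : Integrable B := by
  have h1 : IntegrableOn (fun y : ℝ => y ^ (Module.finrank ℝ V2 - 1) •
      (y⁻¹ * ((1 + y) ^ 4)⁻¹)) (Set.Ioi 0) := by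
    have h := (integrable_one_add_norm (E := ℝ) (μ := volume) (r := 4) (by simp)).integrableOn
      (s := Set.Ioi 0)
    refine h.congr_fun (fun y hy => ?_) measurableSet_Ioi
    have hy : (0 : ℝ) < y := hy
    simp only [Real.norm_of_nonneg hy.le, finrank_euclideanSpace, Fintype.card_fin, smul_eq_mul]
    rw [Real.rpow_neg (by positivity), show (4 : ℝ) = (4 : ℕ) by norm_num, Real.rpow_natCast]
    field_simp
    norm_num
  have h2 := (integrable_fun_norm_addHaar (volume : Measure V2)
    (f := fun y : ℝ => y⁻¹ * ((1 + y) ^ 4)⁻¹)).2 h1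
  exact (h2.const_mul C).mono' hm (.of_forall hB)

theorem norm_mul_norm_le {B : V2 → ℂ} {C : ℝ} (hC : 0 ≤ C)
    (hB : ∀ ξ, ‖B ξ‖ ≤ C * (‖ξ‖⁻¹ * ((1 + ‖ξ‖) ^ 4)⁻¹)) (ξ : V2) :
    ‖ξ‖ * ‖B ξ‖ ≤ C * ((1 + ‖ξ‖) ^ 4)⁻¹ := by
  calc ‖ξ‖ * ‖B ξ‖ ≤ ‖ξ‖ * (C * (‖ξ‖⁻¹ * ((1 + ‖ξ‖) ^ 4)⁻¹)) := by gcongr; exact hB ξ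
    _ = (‖ξ‖ * ‖ξ‖⁻¹) * (C * ((1 + ‖ξ‖) ^ 4)⁻¹) := by ring
    _ ≤ 1 * (C * ((1 + ‖ξ‖) ^ 4)⁻¹) := by gcongr; exact mul_inv_le_one
    _ = _ := one_mul _

theorem integrable_norm_mul_of_norm_le {B : V2 → ℂ} (hm : AEStronglyMeasurable B) {C : ℝ}
    (hC : 0 ≤ C) (hB : ∀ ξ, ‖B ξ‖ ≤ C * (‖ξ‖⁻¹ * ((1 + ‖ξ‖) ^ 4)⁻¹)) :
    Integrable fun ξ => ‖ξ‖ * ‖B ξ‖ := by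
  have h := (integrable_one_add_norm (E := V2) (μ := volume) (r := 4) (by simp; norm_num))
  refine (h.const_mul C).mono' (by fun_prop) (.of_forall fun ξ => ?_)
  rw [Real.norm_of_nonneg (by positivity), Real.rpow_neg (by positivity),
    show (4 : ℝ) = (4 : ℕ) by norm_num, Real.rpow_natCast]
  exact norm_mul_norm_le hC hB ξ

theorem memLp_norm_mul_of_norm_le {B : V2 → ℂ} (hm : AEStronglyMeasurable B) {C : ℝ}
    (hC : 0 ≤ C) (hB : ∀ ξ, ‖B ξ‖ ≤ C * (‖ξ‖⁻¹ * ((1 + ‖ξ‖) ^ 4)⁻¹)) :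
    MemLp (fun ξ => ‖ξ‖ * ‖B ξ‖) 2 := by
  have h1 := integrable_norm_mul_of_norm_le hm hC hB
  refine (memLp_two_iff_integrable_sq h1.1).2 ?_
  simp_rw [sq]
  refine h1.bdd_mul h1.1 (c := C) (.of_forall fun ξ => ?_)
  rw [Real.norm_of_nonneg (by positivity)]
  refine (norm_mul_norm_le hC hB ξ).trans (mul_le_of_le_one_right hC (inv_le_one_of_one_le₀ ?_))
  exact one_le_pow₀ (by linarith [norm_nonneg ξ])

end Decay

section SolitonField

/-- The coordinate multiple `x_l ρ(x)` of a Schwartz function, complexified. -/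
def coordMul (l : Fin 2) (ρ : 𝓢(V2, ℝ)) : 𝓢(V2, ℂ) :=
  SchwartzMap.smulLeftCLM ℂ (inner ℝ · (e2 l)) (toC ρ)

theorem inner_e2 (x : V2) (l : Fin 2) : ⟪x, e2 l⟫ = x l := by
  simp [e2, EuclideanSpace.inner_single_right]

theorem coordMul_apply (l : Fin 2) (ρ : 𝓢(V2, ℝ)) (x : V2) :
    coordMul l ρ x = (x l : ℂ) * ρ x := by
  have hg : (inner ℝ · (e2 l) : V2 → ℝ).HasTemperateGrowth :=
    ((innerSL ℝ).flip (e2 l)).hasTemperateGrowth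
  rw [coordMul, SchwartzMap.smulLeftCLM_apply_apply hg, inner_e2]
  simp

theorem FT_eq_fourier (ρ : 𝓢(V2, ℝ)) :
    FT ρ = fun k => ((2 * Real.pi : ℝ) : ℂ)⁻¹ * 𝓕 (toC ρ) ((2 * Real.pi)⁻¹ • k) := by
  ext k
  rw [FT, SchwartzMap.fourier_coe, Real.fourier_eq']
  congr 2
  ext x
  rw [real_inner_smul_right, real_inner_comm, toC_apply, smul_eq_mul]
  congr 2
  have := Real.pi_ne_zero
  push_cast
  field_simp

theorem pd_FT (ρ : 𝓢(V2, ℝ)) (l : Fin 2) (k : V2) :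
    pd (FT ρ) l k = -Complex.I * ((2 * Real.pi : ℝ) : ℂ)⁻¹ *
      𝓕 (coordMul l ρ) ((2 * Real.pi)⁻¹ • k) := by
  have h1 := (((𝓕 (toC ρ) : 𝓢(V2, ℂ)).differentiableAt
      (x := (2 * Real.pi)⁻¹ • k)).hasFDerivAt.comp k
        ((hasFDerivAt_id k).const_smul (2 * Real.pi)⁻¹)).const_mul (((2 * Real.pi : ℝ) : ℂ)⁻¹)
  replace h1 := h1.congr_of_eventuallyEq (f₁ := FT ρ)
    (.of_forall fun x => congrFun (FT_eq_fourier ρ) x)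
  have h2 : fderiv ℝ (⇑(𝓕 (toC ρ) : 𝓢(V2, ℂ))) ((2 * Real.pi)⁻¹ • k) (e2 l) =
      -(2 * Real.pi * Complex.I) * 𝓕 (coordMul l ρ) ((2 * Real.pi)⁻¹ • k) := by
    rw [← SchwartzMap.lineDerivOp_apply_eq_fderiv, SchwartzMap.lineDerivOp_fourier_eq,
      FourierTransform.fourier_smul]
    rfl
  have hpi : (Real.pi : ℂ) ≠ 0 := by exact_mod_cast Real.pi_ne_zero
  rw [pd, h1.fderiv]
  change ((2 * Real.pi : ℝ) : ℂ)⁻¹ * (fderiv ℝ (⇑(𝓕 (toC ρ) : 𝓢(V2, ℂ))) ((2 * Real.pi)⁻¹ • k)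
    ((2 * Real.pi)⁻¹ • e2 l)) = _
  rw [map_smul, h2, Complex.real_smul]
  push_cast
  field_simp

/-- The soliton field on the frequency side, in the normalization of `𝓕⁻`. -/
def Bsol (ρ : V2 → ℝ) (v : V2) (ω : ℝ) (j : Fin 2) (ξ : V2) : ℂ :=
  2 * Real.pi * Ahat ρ v ω j ((2 * Real.pi) • ξ)

theorem Asol_eq (ρ : V2 → ℝ) (v : V2) (ω : ℝ) (j : Fin 2) :
    Asol ρ v ω j = fun y => (𝓕⁻ (Bsol ρ v ω j) y).re := by
  ext y
  rw [Asol]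
  congr 1
  have h := Measure.integral_comp_smul (volume : Measure V2)
    (fun k : V2 => Complex.exp (Complex.I * ((⟪k, y⟫ : ℝ) : ℂ)) * Ahat ρ v ω j k) (2 * Real.pi)
  have hpi : (Real.pi : ℂ) ≠ 0 := by exact_mod_cast Real.pi_ne_zero
  have e : 𝓕⁻ (Bsol ρ v ω j) y = 2 * Real.pi * ∫ k : V2, Complex.exp (Complex.I *
      ((⟪(2 * Real.pi) • k, y⟫ : ℝ) : ℂ)) * Ahat ρ v ω j ((2 * Real.pi) • k) := by
    rw [Real.fourierInv_eq', ← integral_const_mul]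
    congr 1
    ext k
    rw [real_inner_smul_left, Bsol, smul_eq_mul, mul_comm Complex.I]
    ring
  rw [e, h, abs_of_pos (by positivity)]
  simp
  field_simp

/-- The part of the frequency-side source of the soliton field generated by rotation. -/
def rotSource (ρ : 𝓢(V2, ℝ)) (j : Fin 2) : 𝓢(V2, ℂ) := ![-coordMul 1 ρ, coordMul 0 ρ] j

theorem Bsol_eq (ρ : 𝓢(V2, ℝ)) (v : V2) (ω : ℝ) (j : Fin 2) (ξ : V2) :
    Bsol ρ v ω j ξ = (((v j - ξ j * (⟪v, ξ⟫ : ℝ) / ‖ξ‖ ^ 2 : ℝ) : ℂ) * 𝓕 (toC ρ) ξ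
      + ω * 𝓕 (rotSource ρ j) ξ) / (((2 * Real.pi) ^ 2 * Dv v ξ : ℝ) : ℂ) := by
  have hpi : (2 * Real.pi) ≠ 0 := by positivity
  have hpiC : (Real.pi : ℂ) ≠ 0 := by exact_mod_cast Real.pi_ne_zero
  have hD : Dv v ((2 * Real.pi) • ξ) = (2 * Real.pi) ^ 2 * Dv v ξ := by
    rw [Dv, Dv, norm_smul, real_inner_smul_right, Real.norm_of_nonneg (by positivity)]
    ring
  have hc : v j - ((2 * Real.pi) • ξ) j * (⟪v, (2 * Real.pi) • ξ⟫ : ℝ) / ‖(2 * Real.pi) • ξ‖ ^ 2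
      = v j - ξ j * (⟪v, ξ⟫ : ℝ) / ‖ξ‖ ^ 2 := by
    rw [norm_smul, real_inner_smul_right, Real.norm_of_nonneg (by positivity), PiLp.smul_apply,
      smul_eq_mul, mul_pow, show 2 * Real.pi * ξ j * (2 * Real.pi * ⟪v, ξ⟫) =
        (2 * Real.pi) ^ 2 * (ξ j * ⟪v, ξ⟫) by ring, mul_div_mul_left _ _ (pow_ne_zero 2 hpi)]
  have hs : (2 * Real.pi)⁻¹ • (2 * Real.pi) • ξ = ξ := inv_smul_smul₀ hpi ξ
  rw [Bsol, Ahat, hD, hc, ← mul_div_assoc]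
  congr 1
  have hJ : -(2 * Real.pi * Complex.I) * Jgrad (FT ρ) j ((2 * Real.pi) • ξ)
      = 𝓕 (rotSource ρ j) ξ := by
    have hI := Complex.I_sq
    fin_cases j
    · simp only [Jgrad, rotSource, pd_FT, hs, Fin.zero_eta, Matrix.cons_val_zero,
        FourierTransform.fourier_neg, neg_apply]
      push_cast
      field_simp
      linear_combination (𝓕 (coordMul 1 ρ) ξ) * hI
    · simp only [Jgrad, rotSource, pd_FT, hs, Fin.mk_one, Matrix.cons_val_one]
      push_cast
      field_simp
      simp
  rw [← hJ, FT_eq_fourier]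
  simp only [hs]
  push_cast
  field_simp
  ring

theorem Dv_lower {v : V2} (ξ : V2) : (1 - ‖v‖ ^ 2) * ‖ξ‖ ^ 2 ≤ Dv v ξ := by
  have h := abs_real_inner_le_norm v ξ
  have h2 : ⟪v, ξ⟫ ^ 2 ≤ (‖v‖ * ‖ξ‖) ^ 2 := sq_le_sq' (by linarith [neg_abs_le ⟪v, ξ⟫])
    ((le_abs_self _).trans h)
  rw [Dv]
  nlinarith

theorem abs_apply_le_norm (x : V2) (j : Fin 2) : |x j| ≤ ‖x‖ := PiLp.norm_apply_le x j

theorem abs_projection_le {v : V2} (hv : ‖v‖ < 1) (ξ : V2) (j : Fin 2) :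
    |v j - ξ j * (⟪v, ξ⟫ : ℝ) / ‖ξ‖ ^ 2| ≤ 2 := by
  have h1 : |ξ j * (⟪v, ξ⟫ : ℝ) / ‖ξ‖ ^ 2| ≤ 1 := by
    rw [abs_div, abs_mul, abs_of_nonneg (sq_nonneg ‖ξ‖)]
    refine div_le_one_of_le₀ ?_ (sq_nonneg _)
    calc |ξ j| * |⟪v, ξ⟫| ≤ ‖ξ‖ * (‖v‖ * ‖ξ‖) := by
          gcongr
          · exact abs_apply_le_norm ξ j
          · exact abs_real_inner_le_norm v ξ
      _ ≤ ‖ξ‖ * (1 * ‖ξ‖) := by gcongr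
      _ = _ := by ring
  have h2 := (abs_apply_le_norm v j).trans hv.le
  exact (abs_sub _ _).trans (by linarith)

theorem fourier_zero_eq_integral (φ : 𝓢(V2, ℂ)) : 𝓕 φ 0 = ∫ x, φ x := by
  rw [SchwartzMap.fourier_coe, Real.fourier_eq]
  simp

theorem fourier_toC_zero {ρ : 𝓢(V2, ℝ)} (hneu : (∫ x : V2, ρ x) = 0) : 𝓕 (toC ρ) 0 = 0 := by
  rw [fourier_zero_eq_integral]
  simp only [toC_apply]
  rw [integral_complex_ofReal, hneu, Complex.ofReal_zero]

theorem fourier_coordMul_zero {ρ : 𝓢(V2, ℝ)} (hrad : ∀ x y : V2, ‖x‖ = ‖y‖ → ρ x = ρ y)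
    (l : Fin 2) : 𝓕 (coordMul l ρ) 0 = 0 := by
  rw [fourier_zero_eq_integral]
  have h := integral_neg_eq_self (fun x => coordMul l ρ x) (volume : Measure V2)
  simp only [coordMul_apply, PiLp.neg_apply, hrad (-_) _ (norm_neg _), Complex.ofReal_neg,
    neg_mul, integral_neg] at h ⊢
  linear_combination (-1 / 2 : ℂ) * h

theorem fourier_rotSource_zero {ρ : 𝓢(V2, ℝ)} (hrad : ∀ x y : V2, ‖x‖ = ‖y‖ → ρ x = ρ y)
    (j : Fin 2) : 𝓕 (rotSource ρ j) 0 = 0 := by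
  fin_cases j
  · simp [rotSource, FourierTransform.fourier_neg, fourier_coordMul_zero hrad]
  · simp [rotSource, fourier_coordMul_zero hrad]

theorem aestronglyMeasurable_Bsol (ρ : 𝓢(V2, ℝ)) (v : V2) (ω : ℝ) (j : Fin 2) :
    AEStronglyMeasurable (Bsol ρ v ω j) := by
  rw [funext (Bsol_eq ρ v ω j)]
  have h1 : Measurable (⇑(𝓕 (toC ρ) : 𝓢(V2, ℂ))) := (𝓕 (toC ρ) : 𝓢(V2, ℂ)).continuous.measurable
  have h2 : Measurable (⇑(𝓕 (rotSource ρ j) : 𝓢(V2, ℂ))) :=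
    (𝓕 (rotSource ρ j) : 𝓢(V2, ℂ)).continuous.measurable
  unfold Dv
  refine Measurable.aestronglyMeasurable ?_
  fun_prop

theorem norm_Bsol_le {ρ : 𝓢(V2, ℝ)} (hrad : ∀ x y : V2, ‖x‖ = ‖y‖ → ρ x = ρ y)
    (hneu : (∫ x : V2, ρ x) = 0) {v : V2} (hv : ‖v‖ < 1) (ω : ℝ) (j : Fin 2) :
    ∃ C, 0 ≤ C ∧ ∀ ξ, ‖Bsol ρ v ω j ξ‖ ≤ C * (‖ξ‖⁻¹ * ((1 + ‖ξ‖) ^ 4)⁻¹) := by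
  obtain ⟨C₁, hC₁, h₁⟩ := schwartz_norm_mul_le (fourier_toC_zero hneu)
  obtain ⟨C₂, hC₂, h₂⟩ := schwartz_norm_mul_le (fourier_rotSource_zero hrad j)
  have hv2 : 0 < 1 - ‖v‖ ^ 2 := by nlinarith [norm_nonneg v]
  refine ⟨(2 * C₁ + |ω| * C₂) / (1 - ‖v‖ ^ 2), by positivity, fun ξ => ?_⟩
  rcases eq_or_ne ξ 0 with rfl | hξ
  · simp [Bsol_eq, Dv]
  have hn : 0 < ‖ξ‖ := norm_pos_iff.2 hξ
  have hD : (1 - ‖v‖ ^ 2) * ‖ξ‖ ^ 2 ≤ (2 * Real.pi) ^ 2 * Dv v ξ := by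
    have h1 := Dv_lower (v := v) ξ
    have h2 : 0 ≤ Dv v ξ := le_trans (by positivity) h1
    have h3 : (1 : ℝ) ≤ (2 * Real.pi) ^ 2 := one_le_pow₀ (by linarith [Real.two_le_pi])
    nlinarith
  have hD0 : 0 < (1 - ‖v‖ ^ 2) * ‖ξ‖ ^ 2 := by positivity
  have hN : ‖((v j - ξ j * (⟪v, ξ⟫ : ℝ) / ‖ξ‖ ^ 2 : ℝ) : ℂ) * 𝓕 (toC ρ) ξ
      + ω * 𝓕 (rotSource ρ j) ξ‖ ≤ (2 * C₁ + |ω| * C₂) * ‖ξ‖ / (1 + ‖ξ‖) ^ 4 := by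
    rw [le_div_iff₀ (by positivity)]
    calc _ ≤ (2 * ‖𝓕 (toC ρ) ξ‖ + |ω| * ‖𝓕 (rotSource ρ j) ξ‖) * (1 + ‖ξ‖) ^ 4 := by
          gcongr
          refine (norm_add_le _ _).trans ?_
          rw [norm_mul, norm_mul, Complex.norm_real, Complex.norm_real]
          gcongr
          · exact abs_projection_le hv ξ j
          · exact le_rfl
      _ = 2 * (‖𝓕 (toC ρ) ξ‖ * (1 + ‖ξ‖) ^ 4)
          + |ω| * (‖𝓕 (rotSource ρ j) ξ‖ * (1 + ‖ξ‖) ^ 4) := by ring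
      _ ≤ 2 * (C₁ * ‖ξ‖) + |ω| * (C₂ * ‖ξ‖) := 
          add_le_add (mul_le_mul_of_nonneg_left (h₁ ξ) zero_le_two)
            (mul_le_mul_of_nonneg_left (h₂ ξ) (abs_nonneg ω))
      _ = _ := by ring
  rw [Bsol_eq, norm_div, Complex.norm_real, Real.norm_of_nonneg (hD0.le.trans hD)]
  calc _ ≤ (2 * C₁ + |ω| * C₂) * ‖ξ‖ / (1 + ‖ξ‖) ^ 4 / ((1 - ‖v‖ ^ 2) * ‖ξ‖ ^ 2) := by gcongr
    _ = _ := by field_simp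

end SolitonField

section WeakEquation

theorem integrable_Dv_mul {B : V2 → ℂ} (h0 : AEStronglyMeasurable B)
    (h1 : Integrable fun ξ => ‖ξ‖ * ‖B ξ‖) (φ : 𝓢(V2, ℂ)) (v : V2) :
    Integrable fun ξ => ((2 * Real.pi) ^ 2 * Dv v ξ : ℝ) * B ξ * φ ξ := by
  refine (((integrable_weighted_mul h0 h1 φ (e2 0)).add
    (integrable_weighted_mul h0 h1 φ (e2 1))).sub (integrable_weighted_mul h0 h1 φ v)).congr
    (.of_forall fun ξ => ?_)
  simp only [Pi.add_apply, Pi.sub_apply, inner_e2, Dv, EuclideanSpace.real_norm_sq_eq,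
    Fin.sum_univ_two, real_inner_comm ξ v]
  push_cast
  ring

theorem sum_integral_fderiv_mul_fderiv_sub {B : V2 → ℂ} (h0 : Integrable B)
    (h1 : Integrable fun ξ => ‖ξ‖ * ‖B ξ‖) (φ : 𝓢(V2, ℝ)) (v : V2) :
    (∑ i, ∫ y, fderiv ℝ (fun y => (𝓕⁻ B y).re) y (e2 i) * fderiv ℝ φ y (e2 i))
      - ∫ y, fderiv ℝ (fun y => (𝓕⁻ B y).re) y v * fderiv ℝ φ y v =
      (∫ ξ, ((2 * Real.pi) ^ 2 * Dv v ξ : ℝ) * B ξ * 𝓕⁻ (toC φ) ξ).re := by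
  have hw := integrable_weighted_mul h0.1 h1 (𝓕⁻ (toC φ))
  simp_rw [Fin.sum_univ_two, integral_fderiv_mul_fderiv h0 h1]
  rw [← Complex.add_re, ← Complex.sub_re, ← integral_add (hw _) (hw _),
    ← integral_sub ((hw _).fun_add (hw _)) (hw _)]
  congr 2
  ext ξ
  simp only [inner_e2, Dv, EuclideanSpace.real_norm_sq_eq, Fin.sum_univ_two, real_inner_comm ξ v]
  push_cast
  ring

theorem sum_mul_fourierInv_eq_zero {a : Fin 2 → 𝓢(V2, ℝ)}
    (hdiv : ∀ y : V2, (∑ j, fderiv ℝ (⇑(a j)) y (e2 j)) = 0) (ξ : V2) :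
    ∑ j, (ξ j : ℂ) * 𝓕⁻ (toC (a j)) ξ = 0 := by
  have h : ∂_{e2 0} (a 0) + ∂_{e2 1} (a 1) = 0 := by
    ext y
    simpa [SchwartzMap.lineDerivOp_apply_eq_fderiv, Fin.sum_univ_two] using hdiv y
  have h2 : 𝓕⁻ (toC (∂_{e2 0} (a 0))) ξ + 𝓕⁻ (toC (∂_{e2 1} (a 1))) ξ = 0 := by
    rw [← add_apply, ← FourierTransform.fourierInv_add]
    have : toC (∂_{e2 0} (a 0)) + toC (∂_{e2 1} (a 1)) = 0 := by
      rw [toC, toC, ← map_add, h, map_zero]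
    rw [this]
    simp
  rw [fourierInv_toC_lineDeriv, fourierInv_toC_lineDeriv, inner_e2, inner_e2] at h2
  have hpi : (2 * Real.pi * Complex.I : ℂ) ≠ 0 := Complex.two_pi_I_ne_zero
  rw [Fin.sum_univ_two]
  refine mul_left_cancel₀ hpi ?_
  linear_combination -h2

theorem integral_fourier_mul_fourierInv (φ ψ : 𝓢(V2, ℂ)) :
    ∫ ξ, 𝓕 φ ξ * 𝓕⁻ ψ ξ = ∫ y, φ y * ψ y := by
  rw [SchwartzMap.integral_fourier_mul_eq, FourierTransform.fourier_fourierInv_eq]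

theorem integrable_schwartz_mul (φ ψ : 𝓢(V2, ℂ)) : Integrable fun y => φ y * ψ y :=
  φ.integrable.mul_bdd (c := ‖ψ.toBoundedContinuousFunction‖) ψ.continuous.aestronglyMeasurable
    (.of_forall fun x => ψ.toBoundedContinuousFunction.norm_coe_le_norm x)

theorem Dv_mul_Bsol {ρ : 𝓢(V2, ℝ)} (hrad : ∀ x y : V2, ‖x‖ = ‖y‖ → ρ x = ρ y)
    (hneu : (∫ x : V2, ρ x) = 0) {v : V2} (hv : ‖v‖ < 1) (ω : ℝ) (j : Fin 2) (ξ : V2) :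
    ((2 * Real.pi) ^ 2 * Dv v ξ : ℝ) * Bsol ρ v ω j ξ =
      ((v j - ξ j * (⟪v, ξ⟫ : ℝ) / ‖ξ‖ ^ 2 : ℝ) : ℂ) * 𝓕 (toC ρ) ξ
      + ω * 𝓕 (rotSource ρ j) ξ := by
  rcases eq_or_ne ξ 0 with rfl | hξ
  · simp [fourier_toC_zero hneu, fourier_rotSource_zero hrad, Dv]
  · have hD : 0 < Dv v ξ := lt_of_lt_of_le
      (mul_pos (by nlinarith [norm_nonneg v]) (pow_pos (norm_pos_iff.2 hξ) 2)) (Dv_lower ξ)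
    rw [Bsol_eq]
    refine mul_div_cancel₀ _ ?_
    exact_mod_cast (by positivity : (0 : ℝ) < (2 * Real.pi) ^ 2 * Dv v ξ).ne'

theorem integral_toC_mul_toC (φ ψ : 𝓢(V2, ℝ)) :
    ∫ y, toC φ y * toC ψ y = ((∫ y, ψ y * φ y : ℝ) : ℂ) := by
  rw [← integral_complex_ofReal]
  simp [mul_comm]

theorem integral_rotSource_mul (ρ : 𝓢(V2, ℝ)) (a : Fin 2 → 𝓢(V2, ℝ)) :
    ∑ j, ∫ y, rotSource ρ j y * toC (a j) y =
      ((-angTerm ρ (fun j => ⇑(a j)) : ℝ) : ℂ) := by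
  rw [Fin.sum_univ_two, ← integral_add (integrable_schwartz_mul _ _)
    (integrable_schwartz_mul _ _), angTerm, ← integral_neg, ← integral_complex_ofReal]
  congr 1
  ext y
  simp only [rotSource, Matrix.cons_val_zero, Matrix.cons_val_one, neg_apply, coordMul_apply,
    toC_apply]
  push_cast
  ring

theorem Bsol_integrability {ρ : 𝓢(V2, ℝ)} (hrad : ∀ x y : V2, ‖x‖ = ‖y‖ → ρ x = ρ y)
    (hneu : (∫ x : V2, ρ x) = 0) {v : V2} (hv : ‖v‖ < 1) (ω : ℝ) (j : Fin 2) :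
    Integrable (Bsol ρ v ω j) ∧ Integrable (fun ξ => ‖ξ‖ * ‖Bsol ρ v ω j ξ‖) ∧
      MemLp (fun ξ => ‖ξ‖ * ‖Bsol ρ v ω j ξ‖) 2 := by
  obtain ⟨C, hC, h⟩ := norm_Bsol_le hrad hneu hv ω j
  have hm := aestronglyMeasurable_Bsol ρ v ω j
  exact ⟨integrable_of_norm_le hm h, integrable_norm_mul_of_norm_le hm hC h,
    memLp_norm_mul_of_norm_le hm hC h⟩

theorem Asol_weak_equation {ρ : 𝓢(V2, ℝ)} (hrad : ∀ x y : V2, ‖x‖ = ‖y‖ → ρ x = ρ y)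
    (hneu : (∫ x : V2, ρ x) = 0) {v : V2} (hv : ‖v‖ < 1) (ω : ℝ) {a : Fin 2 → 𝓢(V2, ℝ)}
    (hdiv : ∀ y : V2, (∑ j, fderiv ℝ (⇑(a j)) y (e2 j)) = 0) :
    ∑ j, ((∑ i, ∫ y, fderiv ℝ (Asol ρ v ω j) y (e2 i) * fderiv ℝ (a j) y (e2 i))
      - ∫ y, fderiv ℝ (Asol ρ v ω j) y v * fderiv ℝ (a j) y v) =
      ∑ j, v j * chargeTerm ρ (fun j => ⇑(a j)) j - ω * angTerm ρ (fun j => ⇑(a j)) := by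
  have hB := Bsol_integrability hrad hneu hv ω
  have hi := fun j => integrable_Dv_mul (hB j).1.1 (hB j).2.1 (𝓕⁻ (toC (a j))) v
  have hR := fun j => (integrable_schwartz_mul (𝓕 (toC ρ)) (𝓕⁻ (toC (a j)))).const_mul (v j : ℂ)
  have hS := fun j =>
    (integrable_schwartz_mul (𝓕 (rotSource ρ j)) (𝓕⁻ (toC (a j)))).const_mul (ω : ℂ)
  simp_rw [Asol_eq, fun j => sum_integral_fderiv_mul_fderiv_sub (hB j).1 (hB j).2.1 (a j) v]
  rw [← Complex.re_sum, ← integral_finsetSum _ fun j _ => hi j]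
  have key : ∀ ξ, ∑ j, ((2 * Real.pi) ^ 2 * Dv v ξ : ℝ) * Bsol ρ v ω j ξ * 𝓕⁻ (toC (a j)) ξ =
      ∑ j, ((v j : ℂ) * (𝓕 (toC ρ) ξ * 𝓕⁻ (toC (a j)) ξ)
        + ω * (𝓕 (rotSource ρ j) ξ * 𝓕⁻ (toC (a j)) ξ)) := fun ξ => by
    have h := sum_mul_fourierInv_eq_zero hdiv ξ
    simp_rw [Dv_mul_Bsol hrad hneu hv]
    rw [Fin.sum_univ_two] at h ⊢
    rw [Fin.sum_univ_two]
    push_cast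
    linear_combination (-(⟪v, ξ⟫ : ℝ) / (‖ξ‖ : ℂ) ^ 2 * 𝓕 (toC ρ) ξ) * h
  simp_rw [key]
  rw [integral_finsetSum _ fun j _ => (hR j).fun_add (hS j)]
  simp_rw [fun j => integral_add (hR j) (hS j), integral_const_mul, integral_fourier_mul_fourierInv,
    Finset.sum_add_distrib, ← Finset.mul_sum, integral_rotSource_mul, integral_toC_mul_toC]
  rw [Fin.sum_univ_two, Fin.sum_univ_two]
  simp [chargeTerm]
  ring

end WeakEquation

section Energy

/-- Square integrability of the momentum field and of the first derivatives of a field. -/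
structure FiniteEnergy (A Pf : Fin 2 → V2 → ℝ) : Prop where
  memLp_fderiv : ∀ j w, MemLp (fun y => fderiv ℝ (A j) y w) 2
  memLp_momentum : ∀ j, MemLp (Pf j) 2

theorem memLp_fderiv_schwartz (φ : 𝓢(V2, ℝ)) (w : V2) : MemLp (fun y => fderiv ℝ φ y w) 2 := by
  simp_rw [← SchwartzMap.lineDerivOp_apply_eq_fderiv]
  exact (∂_{w} φ).memLp 2

theorem FiniteEnergy.integrable_energy {A Pf : Fin 2 → V2 → ℝ} (h : FiniteEnergy A Pf) :
    Integrable fun y => (∑ j, (Pf j y) ^ 2) + gradSq A y :=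
  (integrable_finsetSum _ fun j _ => (h.memLp_momentum j).integrable_sq).add
    (integrable_finsetSum _ fun i _ => integrable_finsetSum _ fun j _ =>
      (h.memLp_fderiv j (e2 i)).integrable_sq)

theorem FiniteEnergy.integrable_momentum {A Pf : Fin 2 → V2 → ℝ} (h : FiniteEnergy A Pf) (w : V2) :
    Integrable fun y => ∑ l, Pf l y * fderiv ℝ (A l) y w :=
  integrable_finsetSum _ fun l _ => (h.memLp_momentum l).integrable_mul (h.memLp_fderiv l w)

theorem FiniteEnergy.add_schwartz {A Pf : Fin 2 → V2 → ℝ} (h : FiniteEnergy A Pf)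
    (hA : ∀ j, Differentiable ℝ (A j)) (a π : Fin 2 → 𝓢(V2, ℝ)) :
    FiniteEnergy (fun j y => A j y + a j y) (fun j y => Pf j y + π j y) where
  memLp_fderiv j w := by
    simp_rw [fun y => fderiv_fun_add (hA j y) (a j).differentiableAt]
    exact (h.memLp_fderiv j w).add (memLp_fderiv_schwartz (a j) w)
  memLp_momentum j := (h.memLp_momentum j).add ((π j).memLp 2)

theorem finiteEnergy_schwartz (a π : Fin 2 → 𝓢(V2, ℝ)) :
    FiniteEnergy (fun j => ⇑(a j)) (fun j => ⇑(π j)) where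
  memLp_fderiv j w := memLp_fderiv_schwartz (a j) w
  memLp_momentum j := (π j).memLp 2

theorem apply_eq_sum_e2 (L : V2 →L[ℝ] ℝ) (v : V2) : L v = v 0 * L (e2 0) + v 1 * L (e2 1) := by
  have : v = v 0 • e2 0 + v 1 • e2 1 := by
    ext i
    fin_cases i <;> simp [e2]
  conv_lhs => rw [this]
  simp

theorem energy_add_momentum_sub {A : Fin 2 → V2 → ℝ} (hA : ∀ j, Differentiable ℝ (A j))
    (hL : ∀ j w, MemLp (fun y => fderiv ℝ (A j) y w) 2) (v : V2) (a π : Fin 2 → 𝓢(V2, ℝ)) :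
    fieldEnergy (fun j y => A j y + a j y) (fun j y => -fderiv ℝ (A j) y v + π j y)
      - fieldEnergy A (fun j y => -fderiv ℝ (A j) y v)
      + ∑ l, v l * (momTerm (fun j y => A j y + a j y) (fun j y => -fderiv ℝ (A j) y v + π j y) l
        - momTerm A (fun j y => -fderiv ℝ (A j) y v) l) =
    ∑ j, ((∑ i, ∫ y, fderiv ℝ (A j) y (e2 i) * fderiv ℝ (a j) y (e2 i))
      - ∫ y, fderiv ℝ (A j) y v * fderiv ℝ (a j) y v)
      + ∫ y, (1 / 2 * ((∑ j, (π j y) ^ 2) + gradSq (fun j => ⇑(a j)) y)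
        + ∑ l, π l y * fderiv ℝ (a l) y v) := by
  have h : FiniteEnergy A (fun j y => -fderiv ℝ (A j) y v) := ⟨hL, fun j => (hL j v).neg⟩
  have h' := h.add_schwartz hA a π
  have hs := finiteEnergy_schwartz a π
  have hp : ∀ j w, Integrable fun y => fderiv ℝ (A j) y w * fderiv ℝ (a j) y w :=
    fun j w => (hL j w).integrable_mul (memLp_fderiv_schwartz (a j) w)
  have hps : ∀ j, Integrable fun y =>
      ∑ i, fderiv ℝ (A j) y (e2 i) * fderiv ℝ (a j) y (e2 i) :=
    fun j => integrable_finsetSum Finset.univ fun i _ => hp j (e2 i)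
  simp only [fieldEnergy, momTerm]
  rw [← mul_sub, ← integral_sub h'.integrable_energy h.integrable_energy, ← integral_const_mul]
  simp_rw [fun l => (integral_sub (h'.integrable_momentum (e2 l))
    (h.integrable_momentum (e2 l))).symm, ← integral_const_mul]
  rw [← integral_finsetSum _ fun l _ =>
      ((h'.integrable_momentum (e2 l)).sub' (h.integrable_momentum (e2 l))).const_mul (v l),
    ← integral_add ((h'.integrable_energy.sub' h.integrable_energy).const_mul _)
      (integrable_finsetSum _ fun l _ =>
        ((h'.integrable_momentum (e2 l)).sub' (h.integrable_momentum (e2 l))).const_mul (v l))]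
  simp_rw [fun j => (integral_finsetSum Finset.univ fun i _ => hp j (e2 i)).symm,
    fun j => (integral_sub (hps j) (hp j v)).symm]
  rw [← integral_finsetSum _ fun j _ => (hps j).sub' (hp j v),
    ← integral_add (integrable_finsetSum _ fun j _ => (hps j).sub' (hp j v))
      ((hs.integrable_energy.const_mul _).fun_add (hs.integrable_momentum v))]
  congr 1
  ext y
  simp only [gradSq, fun j => fderiv_fun_add (hA j y) (a j).differentiableAt,
    apply_eq_sum_e2 _ v, Fin.sum_univ_two, add_apply]
  ring

theorem fderiv_apply_sq_le (L : V2 →L[ℝ] ℝ) (v : V2) :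
    (L v) ^ 2 ≤ ‖v‖ ^ 2 * ((L (e2 0)) ^ 2 + (L (e2 1)) ^ 2) := by
  rw [apply_eq_sum_e2 L v, EuclideanSpace.real_norm_sq_eq, Fin.sum_univ_two]
  nlinarith [sq_nonneg (v 0 * L (e2 1) - v 1 * L (e2 0))]

theorem neg_norm_mul_le (L : V2 →L[ℝ] ℝ) (v : V2) (p : ℝ) :
    -(‖v‖ / 2 * (p ^ 2 + ((L (e2 0)) ^ 2 + (L (e2 1)) ^ 2))) ≤ p * L v := by
  set q := (L (e2 0)) ^ 2 + (L (e2 1)) ^ 2 with hq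
  have hq0 : 0 ≤ q := by positivity
  have h1 : |L v| ≤ ‖v‖ * √q := by
    refine abs_le_of_sq_le_sq ?_ (by positivity)
    rw [mul_pow, Real.sq_sqrt hq0]
    exact fderiv_apply_sq_le L v
  have h2 : |p * L v| ≤ |p| * (‖v‖ * √q) := by rw [abs_mul]; gcongr
  have h3 : |p| * √q ≤ (p ^ 2 + q) / 2 := by
    nlinarith [sq_nonneg (|p| - √q), sq_abs p, Real.sq_sqrt hq0]
  nlinarith [neg_abs_le (p * L v), mul_le_mul_of_nonneg_left h3 (norm_nonneg v)]

theorem coercive_bound (v : V2) (a π : Fin 2 → 𝓢(V2, ℝ)) :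
    (1 - ‖v‖) / 2 * ((∫ y, gradSq (fun j => ⇑(a j)) y) + ∫ y, ∑ j, (π j y) ^ 2) ≤
      ∫ y, (1 / 2 * ((∑ j, (π j y) ^ 2) + gradSq (fun j => ⇑(a j)) y)
        + ∑ l, π l y * fderiv ℝ (a l) y v) := by
  have hs := finiteEnergy_schwartz a π
  have hπ : Integrable fun y => ∑ j, (π j y) ^ 2 :=
    integrable_finsetSum _ fun j _ => (hs.memLp_momentum j).integrable_sq
  have hg : Integrable (gradSq fun j => ⇑(a j)) :=
    integrable_finsetSum _ fun i _ => integrable_finsetSum _ fun j _ =>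
      (hs.memLp_fderiv j (e2 i)).integrable_sq
  rw [← integral_add hg hπ, ← integral_const_mul]
  refine integral_mono ((hg.add hπ).const_mul _)
    ((hs.integrable_energy.const_mul _).add (hs.integrable_momentum v)) fun y => ?_
  have h0 := neg_norm_mul_le (fderiv ℝ (a 0) y) v (π 0 y)
  have h1 := neg_norm_mul_le (fderiv ℝ (a 1) y) v (π 1 y)
  simp only [gradSq, Fin.sum_univ_two]
  linarith

theorem relativistic_energy_tangent {m : ℝ} (hm : 0 < m) {v : V2} (hv : ‖v‖ < 1)
    (p : Fin 2 → ℝ) :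
    √(m ^ 2 + ∑ j, (m * v j / √(1 - ‖v‖ ^ 2)) ^ 2)
      + ∑ j, v j * (p j - m * v j / √(1 - ‖v‖ ^ 2)) ≤ √(m ^ 2 + ∑ j, p j ^ 2) := by
  have hv2 : 0 < 1 - ‖v‖ ^ 2 := by nlinarith [norm_nonneg v]
  set g := √(1 - ‖v‖ ^ 2) with hg
  have hgp : 0 < g := Real.sqrt_pos.2 hv2
  have hg2 : g ^ 2 = 1 - ‖v‖ ^ 2 := Real.sq_sqrt hv2.le
  rw [EuclideanSpace.real_norm_sq_eq, Fin.sum_univ_two] at hg2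
  have h1 : √(m ^ 2 + ∑ j, (m * v j / g) ^ 2) = m / g := by
    rw [← Real.sqrt_sq (by positivity : 0 ≤ m / g), Fin.sum_univ_two]
    congr 1
    field_simp
    linear_combination hg2
  have h2 : m * g + (v 0 * p 0 + v 1 * p 1) ≤ √(m ^ 2 + ∑ j, p j ^ 2) := by
    refine Real.le_sqrt_of_sq_le ?_
    rw [Fin.sum_univ_two]
    have e : 1 = g ^ 2 + v 0 ^ 2 + v 1 ^ 2 := by linarith
    nlinarith [sq_nonneg (m * v 0 - p 0 * g), sq_nonneg (m * v 1 - p 1 * g),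
      sq_nonneg (v 0 * p 1 - v 1 * p 0)]
  have h3 : m / g + ∑ j, v j * (p j - m * v j / g) = m * g + (v 0 * p 0 + v 1 * p 1) := by
    rw [Fin.sum_univ_two]
    field_simp
    linear_combination -m * hg2
  rw [h1, h3]
  exact h2

end Energy

section Minimizer

theorem integrable_bounded_mul {A : V2 → ℝ} (hA : Differentiable ℝ A) {C : ℝ}
    (hC : ∀ y, |A y| ≤ C) {g : V2 → ℝ} (hg : Integrable g) : Integrable fun y => A y * g y :=
  hg.bdd_mul hA.continuous.aestronglyMeasurable (c := C) (.of_forall hC)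

theorem integrable_coord_mul (ρ : 𝓢(V2, ℝ)) (l : Fin 2) : Integrable fun y : V2 => y l * ρ y :=
  (coordMul l ρ).integrable.re.congr (.of_forall fun y => by
    simp [coordMul_apply])

theorem chargeTerm_add {A : Fin 2 → V2 → ℝ} (ρ : 𝓢(V2, ℝ)) (hA : ∀ j, Differentiable ℝ (A j))
    (hb : ∀ j, ∃ C, ∀ y, |A j y| ≤ C) (a : Fin 2 → 𝓢(V2, ℝ)) (j : Fin 2) :
    chargeTerm ρ (fun j y => A j y + a j y) j =
      chargeTerm ρ A j + chargeTerm ρ (fun j => ⇑(a j)) j := by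
  obtain ⟨C, hC⟩ := hb j
  simp only [chargeTerm, add_mul]
  exact integral_add (integrable_bounded_mul (hA j) hC ρ.integrable)
    (integrable_bounded_mul (a j).differentiable
      ((a j).toBoundedContinuousFunction.norm_coe_le_norm) ρ.integrable)

theorem angTerm_add {A : Fin 2 → V2 → ℝ} (ρ : 𝓢(V2, ℝ)) (hA : ∀ j, Differentiable ℝ (A j))
    (hb : ∀ j, ∃ C, ∀ y, |A j y| ≤ C) (a : Fin 2 → 𝓢(V2, ℝ)) :
    angTerm ρ (fun j y => A j y + a j y) = angTerm ρ A + angTerm ρ (fun j => ⇑(a j)) := by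
  have key : ∀ B : Fin 2 → V2 → ℝ, (∀ j, Differentiable ℝ (B j)) →
      (∀ j, ∃ C, ∀ y, |B j y| ≤ C) →
      Integrable fun y : V2 => (y 1 * B 0 y - y 0 * B 1 y) * ρ y := fun B hB hb => by
    obtain ⟨C₀, h₀⟩ := hb 0
    obtain ⟨C₁, h₁⟩ := hb 1
    refine ((integrable_bounded_mul (hB 0) h₀ (integrable_coord_mul ρ 1)).sub
      (integrable_bounded_mul (hB 1) h₁ (integrable_coord_mul ρ 0))).congr (.of_forall fun y => ?_)
    simp only [Pi.sub_apply]
    ring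
  rw [angTerm, angTerm, angTerm, ← integral_add (key A hA hb)
    (key _ (fun j => (a j).differentiable) fun j =>
      ⟨_, (a j).toBoundedContinuousFunction.norm_coe_le_norm⟩)]
  congr 1
  ext y
  ring

theorem Hrel_sub_ge {A : Fin 2 → V2 → ℝ} {m I : ℝ} (hm : 0 < m) (hI : 0 < I) (ρ : 𝓢(V2, ℝ))
    (hA : ∀ j, Differentiable ℝ (A j)) (hb : ∀ j, ∃ C, ∀ y, |A j y| ≤ C)
    (hL : ∀ j w, MemLp (fun y => fderiv ℝ (A j) y w) 2) {v : V2} (hv : ‖v‖ < 1) (ω : ℝ)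
    (a π : Fin 2 → 𝓢(V2, ℝ))
    (hweak : ∑ j, ((∑ i, ∫ y, fderiv ℝ (A j) y (e2 i) * fderiv ℝ (a j) y (e2 i))
      - ∫ y, fderiv ℝ (A j) y v * fderiv ℝ (a j) y v) =
      ∑ j, v j * chargeTerm ρ (fun j => ⇑(a j)) j - ω * angTerm ρ (fun j => ⇑(a j)))
    {P : Fin 2 → ℝ} (hP : ∀ j, P j = m * v j / √(1 - ‖v‖ ^ 2)
      - momTerm A (fun j y => -fderiv ℝ (A j) y v) j + chargeTerm ρ A j)
    {M : ℝ} (hM : M = I * ω - angTerm ρ A) :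
    (1 - ‖v‖) / 2 * ((∫ y, gradSq (fun j => ⇑(a j)) y) + ∫ y, ∑ j, (π j y) ^ 2) ≤
      Hrel m I ρ P M (fun j y => A j y + a j y) (fun j y => -fderiv ℝ (A j) y v + π j y)
        - Hrel m I ρ P M A (fun j y => -fderiv ℝ (A j) y v) := by
  have h1 := energy_add_momentum_sub hA hL v a π
  have h2 := coercive_bound v a π
  have h3 := relativistic_energy_tangent hm hv fun j => P j
    + momTerm (fun j y => A j y + a j y) (fun j y => -fderiv ℝ (A j) y v + π j y) j
    - chargeTerm ρ (fun j y => A j y + a j y) j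
  have h4 : ∀ j, P j + momTerm A (fun j y => -fderiv ℝ (A j) y v) j - chargeTerm ρ A j =
      m * v j / √(1 - ‖v‖ ^ 2) := fun j => by rw [hP]; ring
  have h5 : ∑ j, v j * (P j
      + momTerm (fun j y => A j y + a j y) (fun j y => -fderiv ℝ (A j) y v + π j y) j
      - chargeTerm ρ (fun j y => A j y + a j y) j - m * v j / √(1 - ‖v‖ ^ 2)) =
      ∑ l, v l * (momTerm (fun j y => A j y + a j y) (fun j y => -fderiv ℝ (A j) y v + π j y) l
        - momTerm A (fun j y => -fderiv ℝ (A j) y v) l)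
      - ∑ j, v j * chargeTerm ρ (fun j => ⇑(a j)) j := by
    rw [← Finset.sum_sub_distrib]
    refine Finset.sum_congr rfl fun j _ => ?_
    rw [chargeTerm_add ρ hA hb, hP]
    ring
  have h6 : 1 / (2 * I) * (I * ω) ^ 2 + ω * angTerm ρ (fun j => ⇑(a j)) ≤
      1 / (2 * I) * (M + angTerm ρ (fun j y => A j y + a j y)) ^ 2 := by
    rw [angTerm_add ρ hA hb, hM]
    set x := angTerm ρ (fun j => ⇑(a j))
    have e : 1 / (2 * I) * (I * ω - angTerm ρ A + (angTerm ρ A + x)) ^ 2 =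
        1 / (2 * I) * (I * ω) ^ 2 + ω * x + 1 / (2 * I) * x ^ 2 := by
      field_simp
      ring
    rw [e]
    exact le_add_of_nonneg_right (by positivity)
  have h7 : M + angTerm ρ A = I * ω := by rw [hM]; ring
  rw [h5] at h3
  simp only [Hrel, h4, h7]
  linarith

end Minimizer

end SolitonLemmas

/-- orbital-stability lower bound for the relativistic particle: the soliton
is a global minimizer of the relativistic reduced Hamiltonian `H^{rel}_{P,M}` with
`P = P^{rel}_{v,ω}`, `M = M_{v,ω}`. -/
theorem relativistic_soliton_global_minimizer
    (ρ : SchwartzMap V2 ℝ)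
    (hrad : ∀ x y : V2, ‖x‖ = ‖y‖ → ρ x = ρ y)
    (hneu : (∫ x : V2, ρ x) = 0)
    (m I : ℝ) (hm : 0 < m) (hI : 0 < I)
    (v : V2) (hv : ‖v‖ < 1) (ω : ℝ)
    (a π : Fin 2 → SchwartzMap V2 ℝ)
    (hdiva : ∀ y : V2, (∑ j, fderiv ℝ (⇑(a j)) y (e2 j)) = 0)
    (hdivπ : ∀ y : V2, (∑ j, fderiv ℝ (⇑(π j)) y (e2 j)) = 0) :
    Hrel m I (⇑ρ) (Prel (⇑ρ) m v ω) (Msol (⇑ρ) I v ω)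
        (fun j y => Asol (⇑ρ) v ω j y + a j y)
        (fun j y => Pisol (⇑ρ) v ω j y + π j y)
      - Hrel m I (⇑ρ) (Prel (⇑ρ) m v ω) (Msol (⇑ρ) I v ω)
        (Asol (⇑ρ) v ω) (Pisol (⇑ρ) v ω)
      ≥ ((1 - ‖v‖) / 2) *
        ((∫ y : V2, gradSq (fun j => ⇑(a j)) y) + ∫ y : V2, ∑ j, (π j y) ^ 2) := by
  have hB := Bsol_integrability hrad hneu hv ω
  refine Hrel_sub_ge hm hI ρ (fun j => ?_) (fun j => ⟨∫ ξ, ‖Bsol ρ v ω j ξ‖, fun y => ?_⟩)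
    (fun j w => ?_) hv ω a π (Asol_weak_equation hrad hneu hv ω hdiva) (fun j => rfl) rfl
  · rw [Asol_eq]
    exact differentiable_re_fourierInv (hB j).1 (hB j).2.1
  · rw [Asol_eq]
    exact abs_re_fourierInv_le _ y
  · rw [Asol_eq]
    exact memLp_fderiv_re_fourierInv (hB j).1 (hB j).2.1 (hB j).2.2 w

end
end

section
/- Let m > 0, I > 0, 0 ≤ s < 1, ω ∈ ℝ, let g, h : ℝ² → [0,∞) be measurable, set D(k) = (1−s²)k₁² + k₂², and assume all integrals below are finite. Define E := m + ∫ k₂²g/(|k|²D) + 5s²∫ k₁²k₂²g/(|k|²D²) + 4s⁴∫ k₁⁴k₂²g/(|k|²D³), a := ∫ h/D, b := ∫ k₁²h/D², c := ∫ k₁⁴h/D³. Then (E + ω²(b + 4s²c))·(I + a) − 4ω²s²b² ≥ mI > 0. (Positivity of the 2×2 block ∂P₁/∂v₁·∂M/∂ω − ∂M/∂v₁·∂P₁/∂ω in the Jacobian lemma.) -/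
open MeasureTheory

noncomputable section

/-- `D(k) = (1-s²)k₁² + k₂²`. -/
def Ds (s : ℝ) (k : ℝ × ℝ) : ℝ := (1 - s ^ 2) * k.1 ^ 2 + k.2 ^ 2

/-- `|k|² = k₁² + k₂²`. -/
def nsq (k : ℝ × ℝ) : ℝ := k.1 ^ 2 + k.2 ^ 2

lemma Ds_nonneg {s : ℝ} (hs0 : 0 ≤ s) (hs1 : s < 1) (k : ℝ × ℝ) : 0 ≤ Ds s k := by
  have h : 0 ≤ 1 - s ^ 2 := by nlinarith
  unfold Ds
  positivity

lemma nsq_nonneg (k : ℝ × ℝ) : 0 ≤ nsq k := by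
  unfold nsq
  positivity

/-- Cauchy–Schwarz for integrals of coefficients of a pointwise nonnegative quadratic form. -/
lemma sq_integral_le_integral_mul_integral {α : Type*} [MeasurableSpace α] {μ : Measure α}
    {A B C : α → ℝ}
    (hA : Integrable A μ) (hB : Integrable B μ) (hC : Integrable C μ)
    (hpos : ∀ (t : ℝ) (x : α), 0 ≤ A x * t ^ 2 + B x * (-2 * t) + C x) :
    (∫ x, B x ∂μ) ^ 2 ≤ (∫ x, A x ∂μ) * ∫ x, C x ∂μ := by
  have key (t : ℝ) :
      0 ≤ (∫ x, A x ∂μ) * (t * t) + (-2 * ∫ x, B x ∂μ) * t + ∫ x, C x ∂μ := by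
    have h : 0 ≤ ∫ x, (A x * t ^ 2 + B x * (-2 * t) + C x) ∂μ := integral_nonneg fun x => hpos t x
    have hAB : Integrable (fun x => A x * t ^ 2 + B x * (-2 * t)) μ :=
      (hA.mul_const _).add (hB.mul_const _)
    rw [integral_add hAB hC, integral_add (hA.mul_const _) (hB.mul_const _), integral_mul_const,
      integral_mul_const] at h
    linarith
  have := discrim_le_zero key
  unfold discrim at this
  linarith

/-- positivity of the `2×2` block
`∂P₁/∂v₁·∂M/∂ω − ∂M/∂v₁·∂P₁/∂ω` in the Jacobian lemma:
`(E + ω²(b + 4s²c))·(I + a) − 4ω²s²b² ≥ mI > 0`. -/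
theorem jacobian_block_positivity
    (m I s ω : ℝ) (hm : 0 < m) (hI : 0 < I) (hs0 : 0 ≤ s) (hs1 : s < 1)
    (g h : ℝ × ℝ → ℝ) (hgm : Measurable g) (hg : ∀ k, 0 ≤ g k)
    (hhm : Measurable h) (hh : ∀ k, 0 ≤ h k)
    (hg1 : Integrable (fun k => k.2 ^ 2 * g k / (nsq k * Ds s k)))
    (hg2 : Integrable (fun k => k.1 ^ 2 * k.2 ^ 2 * g k / (nsq k * (Ds s k) ^ 2)))
    (hg3 : Integrable (fun k => k.1 ^ 4 * k.2 ^ 2 * g k / (nsq k * (Ds s k) ^ 3)))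
    (hh1 : Integrable (fun k => h k / Ds s k))
    (hh2 : Integrable (fun k => k.1 ^ 2 * h k / (Ds s k) ^ 2))
    (hh3 : Integrable (fun k => k.1 ^ 4 * h k / (Ds s k) ^ 3)) :
    0 < m * I ∧
    m * I ≤
      ((m + (∫ k, k.2 ^ 2 * g k / (nsq k * Ds s k))
          + 5 * s ^ 2 * (∫ k, k.1 ^ 2 * k.2 ^ 2 * g k / (nsq k * (Ds s k) ^ 2))
          + 4 * s ^ 4 * (∫ k, k.1 ^ 4 * k.2 ^ 2 * g k / (nsq k * (Ds s k) ^ 3)))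
        + ω ^ 2 * ((∫ k, k.1 ^ 2 * h k / (Ds s k) ^ 2)
            + 4 * s ^ 2 * (∫ k, k.1 ^ 4 * h k / (Ds s k) ^ 3)))
        * (I + (∫ k, h k / Ds s k))
      - 4 * ω ^ 2 * s ^ 2 * (∫ k, k.1 ^ 2 * h k / (Ds s k) ^ 2) ^ 2 := by
  have hD := Ds_nonneg hs0 hs1
  have hn := nsq_nonneg
  have hCS := sq_integral_le_integral_mul_integral hh1 hh2 hh3 (fun t k => by
    have h0 : 0 ≤ h k / Ds s k * (t - k.1 ^ 2 / Ds s k) ^ 2 :=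
      mul_nonneg (div_nonneg (hh k) (hD k)) (sq_nonneg _)
    have e : h k / Ds s k * t ^ 2 + k.1 ^ 2 * h k / Ds s k ^ 2 * (-2 * t)
        + k.1 ^ 4 * h k / Ds s k ^ 3 = h k / Ds s k * (t - k.1 ^ 2 / Ds s k) ^ 2 := by
      ring
    rwa [e])
  have p1 : 0 ≤ ∫ k, k.2 ^ 2 * g k / (nsq k * Ds s k) := integral_nonneg fun k => by
    have := hD k; have := hn k; have := hg k
    dsimp only [Pi.zero_apply]; positivity
  have p2 : 0 ≤ ∫ k, k.1 ^ 2 * k.2 ^ 2 * g k / (nsq k * (Ds s k) ^ 2) :=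
    integral_nonneg fun k => by
      have := hD k; have := hn k; have := hg k
      dsimp only [Pi.zero_apply]; positivity
  have p3 : 0 ≤ ∫ k, k.1 ^ 4 * k.2 ^ 2 * g k / (nsq k * (Ds s k) ^ 3) :=
    integral_nonneg fun k => by
      have := hD k; have := hn k; have := hg k
      dsimp only [Pi.zero_apply]; positivity
  have pa : 0 ≤ ∫ k, h k / Ds s k := integral_nonneg fun k => div_nonneg (hh k) (hD k)
  have pb : 0 ≤ ∫ k, k.1 ^ 2 * h k / (Ds s k) ^ 2 := integral_nonneg fun k => by
    have := hD k; have := hh k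
    dsimp only [Pi.zero_apply]; positivity
  have pc : 0 ≤ ∫ k, k.1 ^ 4 * h k / (Ds s k) ^ 3 := integral_nonneg fun k => by
    have := hD k; have := hh k
    dsimp only [Pi.zero_apply]; positivity
  refine ⟨mul_pos hm hI, ?_⟩
  generalize (∫ k, k.2 ^ 2 * g k / (nsq k * Ds s k)) = e₁ at *
  generalize (∫ k, k.1 ^ 2 * k.2 ^ 2 * g k / (nsq k * (Ds s k) ^ 2)) = e₂ at *
  generalize (∫ k, k.1 ^ 4 * k.2 ^ 2 * g k / (nsq k * (Ds s k) ^ 3)) = e₃ at *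
  generalize (∫ k, h k / Ds s k) = a at *
  generalize (∫ k, k.1 ^ 2 * h k / (Ds s k) ^ 2) = b at *
  generalize (∫ k, k.1 ^ 4 * h k / (Ds s k) ^ 3) = c at *
  have h1 : 0 ≤ 4 * ω ^ 2 * s ^ 2 * (a * c - b ^ 2) :=
    mul_nonneg (by positivity) (sub_nonneg.2 hCS)
  have h2 : 0 ≤ m * a + (e₁ + 5 * s ^ 2 * e₂ + 4 * s ^ 4 * e₃ + ω ^ 2 * b) * (I + a)
      + 4 * ω ^ 2 * s ^ 2 * c * I := by positivity
  linarith

end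
end

section
/- Let ρ be a real-valued radial neutral Schwartz function on ℝ², let m > 0, I > 0. Define F : Σ → ℝ² × ℝ on Σ = {(v,ω) ∈ ℝ² × ℝ : |v| < 1} by F(v,ω) = (P(v,ω), M(v,ω)), where, with D_v(k) = |k|² − (v·k)², P_j(v,ω) = m v_j + v_j ∫ |ρ̂|²/D_v − ∫ (v·k)k_j |ρ̂|²/(|k|² D_v) + ∫ (|v|² − (v·k)²/|k|²)(v·k)k_j |ρ̂|²/D_v² + ω² ∫ (v·k)k_j |∇ρ̂|²/D_v² (j = 1,2) and M(v,ω) = ω( I + ∫ |∇ρ̂|²/D_v ). Then F is differentiable on Σ and the Jacobian determinant det ∂(P,M)/∂(v,ω) is strictly positive at every point of Σ; in particular it never vanishes. -/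
open MeasureTheory
open scoped RealInnerProductSpace BigOperators

noncomputable section

/-- The soliton total linear momentum `P(v,ω)`, via its Fourier integral formula. -/
def Pform (ρ : V2 → ℝ) (m : ℝ) (v : V2) (ω : ℝ) (j : Fin 2) : ℝ :=
  m * v j
    + v j * (∫ k : V2, ‖FT ρ k‖ ^ 2 / Dv v k)
    - (∫ k : V2, (⟪v, k⟫ : ℝ) * k j * ‖FT ρ k‖ ^ 2 / (‖k‖ ^ 2 * Dv v k))
    + (∫ k : V2, (‖v‖ ^ 2 - (⟪v, k⟫ : ℝ) ^ 2 / ‖k‖ ^ 2) * (⟪v, k⟫ : ℝ) * k j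
        * ‖FT ρ k‖ ^ 2 / (Dv v k) ^ 2)
    + ω ^ 2 * (∫ k : V2, (⟪v, k⟫ : ℝ) * k j * gradNormSqC (FT ρ) k / (Dv v k) ^ 2)

/-- The soliton total angular momentum `M(v,ω)`, via its Fourier integral formula. -/
def Mform (ρ : V2 → ℝ) (I : ℝ) (v : V2) (ω : ℝ) : ℝ :=
  ω * (I + ∫ k : V2, gradNormSqC (FT ρ) k / Dv v k)

/-- The momentum map `F(v,ω) = (P(v,ω), M(v,ω))`. -/
def Fmap (ρ : V2 → ℝ) (m I : ℝ) (p : V2 × ℝ) : V2 × ℝ :=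
  ((WithLp.equiv 2 (Fin 2 → ℝ)).symm (fun j => Pform ρ m p.1 p.2 j), Mform ρ I p.1 p.2)

open Filter Topology Metric

open scoped SchwartzMap FourierTransform LineDeriv

/-- The Fourier transform of a Schwartz density, in the normalization `FT`, as a Schwartz map. -/
lemma exists_schwartzMap_eq_FT (ρ : SchwartzMap V2 ℝ) :
    ∃ g : SchwartzMap V2 ℂ, ∀ k, g k = FT ρ k := by
  have hpi : (2 * Real.pi)⁻¹ ≠ 0 := by positivity
  let L : V2 ≃L[ℝ] V2 := ContinuousLinearEquiv.smulLeft (Units.mk0 _ hpi)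
  let ρC : SchwartzMap V2 ℂ := SchwartzMap.postcompCLM (𝕜 := ℝ) Complex.ofRealCLM ρ
  refine ⟨((2 * Real.pi : ℝ) : ℂ)⁻¹ • SchwartzMap.compCLMOfContinuousLinearEquiv ℝ L (𝓕 ρC), ?_⟩
  intro k
  have h : (𝓕 ρC) (L k) = ∫ x : V2, Complex.exp (-Complex.I * ((⟪k, x⟫ : ℝ) : ℂ)) * (ρ x : ℂ) := by
    rw [SchwartzMap.fourier_coe, Real.fourier_eq']
    refine integral_congr_ae (Eventually.of_forall fun x => ?_)
    have hL : L k = (2 * Real.pi)⁻¹ • k := rfl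
    have hx : -2 * Real.pi * (inner ℝ x (L k) : ℝ) = - (inner ℝ k x : ℝ) := by
      rw [hL, inner_smul_right, real_inner_comm]
      field_simp
    simp only [hx, smul_eq_mul]
    congr 2
    push_cast
    ring
  change ((2 * Real.pi : ℝ) : ℂ)⁻¹ • (𝓕 ρC) (L k) = _
  rw [h]
  rfl

lemma FT_neg (ρ : V2 → ℝ) (h : ∀ x, ρ (-x) = ρ x) (k : V2) : FT ρ (-k) = FT ρ k := by
  unfold FT
  congr 1
  rw [← integral_neg_eq_self]
  simp [h]

lemma fderiv_zero_of_even {E F : Type*} [NormedAddCommGroup E] [NormedSpace ℝ E]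
    [NormedAddCommGroup F] [NormedSpace ℝ F] {f : E → F} (h : ∀ x, f (-x) = f x) :
    fderiv ℝ f 0 = 0 := by
  by_cases hf : DifferentiableAt ℝ f 0
  · have h1 : HasFDerivAt (fun x => f (-x)) ((fderiv ℝ f 0).comp (-ContinuousLinearMap.id ℝ E)) 0 :=
      HasFDerivAt.comp (g := f) 0 (by simpa using hf.hasFDerivAt) (hasFDerivAt_id (0 : E)).neg
    have h2 : (fun x => f (-x)) = f := funext h
    rw [h2] at h1
    have h3 := hf.hasFDerivAt.unique h1
    rw [ContinuousLinearMap.comp_neg, ContinuousLinearMap.comp_id] at h3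
    have h4 : (2 : ℝ) • fderiv ℝ f 0 = 0 := by
      rw [two_smul]
      nth_rewrite 1 [h3]
      exact neg_add_cancel _
    exact (smul_eq_zero.mp h4).resolve_left two_ne_zero
  · exact fderiv_zero_of_not_differentiableAt hf

lemma integrable_norm_sq_div_norm_sq (g : SchwartzMap V2 ℂ) (h0 : g 0 = 0) :
    Integrable fun k => ‖g k‖ ^ 2 / ‖k‖ ^ 2 := by
  set C := SchwartzMap.seminorm ℝ 0 0 (SchwartzMap.fderivCLM ℝ V2 ℂ g)
  set C₀ := SchwartzMap.seminorm ℝ 0 0 g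
  have hg : ∀ k, ‖g k‖ ≤ C * ‖k‖ := by
    intro k
    have := convex_univ.norm_image_sub_le_of_norm_fderiv_le (𝕜 := ℝ) (f := g) (x := 0) (y := k)
      (C := C) (fun x _ => g.differentiableAt)
      (fun x _ => by
        rw [← SchwartzMap.fderivCLM_apply (𝕜 := ℝ)]
        exact SchwartzMap.norm_le_seminorm ℝ _ x) trivial trivial
    simpa [h0] using this
  have hint : Integrable fun k => (closedBall (0 : V2) 1).indicator (fun _ => C ^ 2) k
      + C₀ * ‖g k‖ := by
    refine Integrable.add ?_ (g.integrable.norm.const_mul _)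
    rw [integrable_indicator_iff measurableSet_closedBall]
    exact integrableOn_const measure_closedBall_lt_top.ne
  refine hint.mono' ?_ (Eventually.of_forall fun k => ?_)
  · have : Measurable g := g.continuous.measurable
    exact Measurable.aestronglyMeasurable (by fun_prop)
  · rw [Real.norm_of_nonneg (by positivity)]
    have hC₀ : ‖g k‖ ≤ C₀ := SchwartzMap.norm_le_seminorm ℝ g k
    have hk := hg k
    have hn := norm_nonneg (g k)
    by_cases hk1 : k ∈ closedBall (0 : V2) 1
    · rw [Set.indicator_of_mem hk1]
      have : ‖g k‖ ^ 2 / ‖k‖ ^ 2 ≤ C ^ 2 := by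
        refine div_le_of_le_mul₀ (by positivity) (by positivity) ?_
        rw [← mul_pow]
        exact pow_le_pow_left₀ hn hk 2
      nlinarith
    · rw [Set.indicator_of_notMem hk1]
      have hk2 : 1 ≤ ‖k‖ := by
        rw [mem_closedBall_zero_iff, not_le] at hk1
        exact hk1.le
      have : ‖g k‖ ^ 2 / ‖k‖ ^ 2 ≤ ‖g k‖ ^ 2 := div_le_self (by positivity) (one_le_pow₀ hk2)
      nlinarith

lemma integrable_FT_weight (ρ : SchwartzMap V2 ℝ) (hneu : (∫ x : V2, ρ x) = 0) :
    Integrable fun k => ‖FT ρ k‖ ^ 2 / ‖k‖ ^ 2 := by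
  obtain ⟨g, hg⟩ := exists_schwartzMap_eq_FT ρ
  simp_rw [← hg]
  refine integrable_norm_sq_div_norm_sq g ?_
  rw [hg, FT]
  have : (∫ x : V2, (ρ x : ℂ)) = 0 := by rw [integral_complex_ofReal, hneu, Complex.ofReal_zero]
  simp [this]

lemma integrable_gradNormSqC_weight (ρ : SchwartzMap V2 ℝ) (heven : ∀ x, ρ (-x) = ρ x) :
    Integrable fun k => gradNormSqC (FT ρ) k / ‖k‖ ^ 2 := by
  obtain ⟨g, hg⟩ := exists_schwartzMap_eq_FT ρ
  have hfun : FT ρ = g := (funext hg).symm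
  simp_rw [gradNormSqC, Finset.sum_div]
  refine integrable_finsetSum _ fun j _ => ?_
  have hpd : ∀ k, pd (FT ρ) j k = (∂_{e2 j} g : SchwartzMap V2 ℂ) k := fun k => by
    rw [pd, hfun, SchwartzMap.lineDerivOp_apply_eq_fderiv]
  simp_rw [hpd]
  refine integrable_norm_sq_div_norm_sq _ ?_
  rw [← hpd, pd, fderiv_zero_of_even (FT_neg ρ heven)]
  rfl

lemma integrable_smul_comp_of_continuousOn {H : Type*} [NormedAddCommGroup H] [NormedSpace ℝ H]
    {w : V2 → ℝ} (hw : Integrable w) {n : V2 → V2} (hn : Measurable n) (hn1 : ∀ k, ‖n k‖ ≤ 1)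
    {h : V2 → H} (hh : ContinuousOn h (closedBall 0 1)) :
    Integrable fun k => w k • h (n k) := by
  have hmem : ∀ k, n k ∈ closedBall (0 : V2) 1 := fun k => mem_closedBall_zero_iff.2 (hn1 k)
  obtain ⟨C, hC⟩ := (isCompact_closedBall (0 : V2) 1).exists_bound_of_continuousOn hh
  refine hw.smul_bdd C ?_ (Eventually.of_forall fun k => hC _ (hmem k))
  have h1 := hh.aestronglyMeasurable (μ := Measure.map n volume) measurableSet_closedBall
  have h2 : (Measure.map n volume).restrict (closedBall (0 : V2) 1) = Measure.map n volume := by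
    rw [Measure.restrict_map hn measurableSet_closedBall, Set.eq_univ_of_forall (s := n ⁻¹' closedBall 0 1) hmem,
      Measure.restrict_univ]
  rw [h2] at h1
  exact h1.comp_measurable hn

/-- Differentiation under an integral with integrable weight of a `C¹` function of a parameter and
of a point of the unit ball; linear functionals that are nondecreasing along a direction `x` for
every integrand are nonnegative on the derivative of the integral in the direction `x`. -/
lemma exists_hasFDerivAt_integral_smul {E H : Type*} [NormedAddCommGroup E] [NormedSpace ℝ E]
    [FiniteDimensional ℝ E] [NormedAddCommGroup H] [NormedSpace ℝ H] [CompleteSpace H]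
    {w : V2 → ℝ} (hw : Integrable w) (hw0 : ∀ k, 0 ≤ w k)
    {n : V2 → V2} (hn : Measurable n) (hn1 : ∀ k, ‖n k‖ ≤ 1)
    {φ : E × V2 → H} {U : Set (E × V2)} (hU : IsOpen U) (hφ : ContDiffOn ℝ 1 φ U)
    {p₀ : E} (hp₀ : ∀ y ∈ closedBall (0 : V2) 1, (p₀, y) ∈ U) :
    ∃ L : E →L[ℝ] H, HasFDerivAt (fun p => ∫ k, w k • φ (p, n k)) L p₀ ∧
      ∀ (x : E) (l : H →L[ℝ] ℝ),
        (∀ k, w k ≠ 0 → 0 ≤ deriv (fun t : ℝ => l (φ (p₀ + t • x, n k))) 0) → 0 ≤ l (L x) := by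
  have : ProperSpace E := FiniteDimensional.proper ℝ E
  set K := closedBall (0 : V2) 1 with hK
  have hmem : ∀ k, n k ∈ K := fun k => mem_closedBall_zero_iff.2 (hn1 k)
  obtain ⟨u, v, hu, -, hpu, hKv, huv⟩ := generalized_tube_lemma (s := {p₀}) (t := K)
    isCompact_singleton (isCompact_closedBall _ _) hU (by
      rintro ⟨p, y⟩ ⟨hp, hy⟩
      obtain rfl : p = p₀ := hp
      exact hp₀ y hy)
  obtain ⟨ε, hε, hεu⟩ := nhds_basis_closedBall.mem_iff.1
    (hu.mem_nhds (hpu (Set.mem_singleton _)))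
  have hsub : ∀ p ∈ closedBall p₀ ε, ∀ y ∈ K, (p, y) ∈ U := fun p hp y hy =>
    huv ⟨hεu hp, hKv hy⟩
  let D : E × V2 → E →L[ℝ] H := fun q => (fderiv ℝ φ q).comp (ContinuousLinearMap.inl ℝ E V2)
  have hD : ContinuousOn D U :=
    (hφ.continuousOn_fderiv_of_isOpen hU le_rfl).clm_comp continuousOn_const
  have hφD : ∀ q ∈ U, HasFDerivAt (fun p => φ (p, q.2)) (D q) q.1 := fun q hq => by
    have h1 : HasFDerivAt φ (fderiv ℝ φ q) q :=
      ((hφ.contDiffAt (hU.mem_nhds hq)).differentiableAt one_ne_zero).hasFDerivAt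
    exact HasFDerivAt.comp (g := φ) q.1 h1 (hasFDerivAt_prodMk_left q.1 q.2)
  obtain ⟨C, hC⟩ := ((isCompact_closedBall p₀ ε).prod (isCompact_closedBall (0 : V2) 1)
    ).exists_bound_of_continuousOn (hD.mono fun q hq => hsub q.1 hq.1 q.2 hq.2)
  have hslice : ∀ p ∈ closedBall p₀ ε, ContinuousOn (fun y : V2 => (p, y)) K ∧
      Set.MapsTo (fun y : V2 => (p, y)) K U := fun p hp =>
    ⟨by fun_prop, fun y hy => hsub p hp y hy⟩
  have hp₀ε : p₀ ∈ closedBall p₀ ε := mem_closedBall_self hε.le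
  have hint : ∀ p ∈ closedBall p₀ ε, Integrable fun k => w k • φ (p, n k) := fun p hp =>
    integrable_smul_comp_of_continuousOn hw hn hn1
      (hφ.continuousOn.comp (hslice p hp).1 (hslice p hp).2)
  have hintD : Integrable fun k => w k • D (p₀, n k) :=
    integrable_smul_comp_of_continuousOn hw hn hn1
      (hD.comp (hslice p₀ hp₀ε).1 (hslice p₀ hp₀ε).2)
  refine ⟨∫ k, w k • D (p₀, n k), ?_, ?_⟩
  · refine hasFDerivAt_integral_of_dominated_of_fderiv_le (𝕜 := ℝ)
      (F' := fun p k => w k • D (p, n k)) (bound := fun k => w k * C)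
      (closedBall_mem_nhds p₀ hε) ?_ (hint p₀ hp₀ε) hintD.aestronglyMeasurable ?_
      (hw.mul_const C) ?_
    · filter_upwards [closedBall_mem_nhds p₀ hε] with p hp using (hint p hp).aestronglyMeasurable
    · refine Eventually.of_forall fun k p hp => ?_
      rw [norm_smul, Real.norm_of_nonneg (hw0 k)]
      exact mul_le_mul_of_nonneg_left (hC (p, n k) ⟨hp, hmem k⟩) (hw0 k)
    · exact Eventually.of_forall fun k p hp =>
        (hφD (p, n k) (hsub p hp _ (hmem k))).const_smul (w k)
  · intro x l hx
    have h1 : l ((∫ k, w k • D (p₀, n k)) x) = ∫ k, w k * l (D (p₀, n k) x) := by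
      rw [ContinuousLinearMap.integral_apply hintD, ← l.integral_comp_comm (hintD.apply_continuousLinearMap x)]
      simp
    rw [h1]
    refine integral_nonneg fun k => ?_
    rcases eq_or_ne (w k) 0 with h0 | h0
    · simp [h0]
    · refine mul_nonneg (hw0 k) ?_
      have h2 : HasDerivAt (fun t : ℝ => p₀ + t • x) x 0 := by
        simpa using ((hasDerivAt_id (0 : ℝ)).smul_const x).const_add p₀
      have h3 : HasFDerivAt (fun p => φ (p, n k)) (D (p₀, n k)) (p₀ + (0 : ℝ) • x) := by
        simpa using hφD (p₀, n k) (hp₀ _ (hmem k))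
      have h4 := (l.hasFDerivAt.comp_hasDerivAt (0 : ℝ) (h3.comp_hasDerivAt (0 : ℝ) h2)).deriv
      have h5 := hx k h0
      rwa [← h4]

/-- A linear endomorphism which pairs positively with every nonzero vector has positive
determinant. -/
lemma det_pos_of_pairing_pos {E : Type*} [AddCommGroup E] [Module ℝ E] [FiniteDimensional ℝ E]
    (A : E →ₗ[ℝ] E) (l : E → E →ₗ[ℝ] ℝ) (hl : ∀ x ≠ 0, 0 < l x x) (hA : ∀ x ≠ 0, 0 < l x (A x)) :
    0 < LinearMap.det A := by
  let B : ℝ → E →ₗ[ℝ] E := fun t => (1 - t) • LinearMap.id + t • A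
  have hB : ∀ t ∈ Set.Icc (0 : ℝ) 1, LinearMap.det (B t) ≠ 0 := by
    intro t ht h0
    obtain ⟨x, hx, hx0⟩ := (Submodule.ne_bot_iff _).1 (LinearMap.bot_lt_ker_of_det_eq_zero h0).ne'
    have h1 : l x (B t x) = (1 - t) * l x x + t * l x (A x) := by simp [B]
    rw [LinearMap.mem_ker.1 hx, map_zero] at h1
    have h2 := hl x hx0
    have h3 := hA x hx0
    rcases eq_or_lt_of_le ht.1 with rfl | ht0
    · linarith
    · nlinarith [mul_nonneg (sub_nonneg.2 ht.2) h2.le, mul_pos ht0 h3]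
  have hcont : ContinuousOn (fun t => LinearMap.det (B t)) (Set.Icc 0 1) := by
    let b := Module.finBasis ℝ E
    simp_rw [← LinearMap.det_toMatrix b, B, map_add, map_smul]
    fun_prop
  by_contra! hneg
  obtain ⟨t, ht, h0⟩ := intermediate_value_Icc' zero_le_one hcont
    (show (0 : ℝ) ∈ _ from ⟨by simpa [B] using hneg, by simp [B]⟩)
  exact hB t ht h0

/-- Integrand of the momentum carried by the charge, against the weight `|ρ̂(k)|² / |k|²`, as a
function of `((v, ω), k / |k|)`. -/
def chargeMomentum (q : (V2 × ℝ) × V2) : V2 × ℝ :=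
  ((1 - ⟪q.1.1, q.2⟫ ^ 2)⁻¹ • q.1.1 +
    ((‖q.1.1‖ ^ 2 - ⟪q.1.1, q.2⟫ ^ 2) * ⟪q.1.1, q.2⟫ * ((1 - ⟪q.1.1, q.2⟫ ^ 2)⁻¹) ^ 2
      - ⟪q.1.1, q.2⟫ * (1 - ⟪q.1.1, q.2⟫ ^ 2)⁻¹) • q.2, 0)

/-- Integrand of the momentum carried by the rotation, against the weight `|∇ρ̂(k)|² / |k|²`, as a
function of `((v, ω), k / |k|)`. -/
def spinMomentum (q : (V2 × ℝ) × V2) : V2 × ℝ :=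
  ((q.1.2 ^ 2 * ⟪q.1.1, q.2⟫ * ((1 - ⟪q.1.1, q.2⟫ ^ 2)⁻¹) ^ 2) • q.2,
    q.1.2 * (1 - ⟪q.1.1, q.2⟫ ^ 2)⁻¹)

/-- The set on which `chargeMomentum` and `spinMomentum` are smooth. -/
def subluminal : Set ((V2 × ℝ) × V2) := {q | (⟪q.1.1, q.2⟫ : ℝ) ^ 2 < 1}

lemma isOpen_subluminal : IsOpen subluminal :=
  isOpen_lt (by fun_prop) continuous_const

lemma inner_sq_lt_one {v y : V2} (hv : ‖v‖ < 1) (hy : ‖y‖ ≤ 1) : (⟪v, y⟫ : ℝ) ^ 2 < 1 := by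
  rw [sq_lt_one_iff_abs_lt_one]
  calc |(⟪v, y⟫ : ℝ)| ≤ ‖v‖ * ‖y‖ := abs_real_inner_le_norm v y
    _ ≤ ‖v‖ := mul_le_of_le_one_right (norm_nonneg v) hy
    _ < 1 := hv

lemma contDiffOn_inv_one_sub_inner_sq :
    ContDiffOn ℝ 1 (fun q : (V2 × ℝ) × V2 => (1 - (⟪q.1.1, q.2⟫ : ℝ) ^ 2)⁻¹) subluminal := by
  refine ContDiffOn.inv ?_ fun q hq => (sub_pos.2 hq).ne'
  exact (contDiff_const.sub ((contDiff_fst.fst.inner ℝ contDiff_snd).pow 2)).contDiffOn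

lemma contDiffOn_chargeMomentum : ContDiffOn ℝ 1 chargeMomentum subluminal := by
  have hr := contDiffOn_inv_one_sub_inner_sq
  have hs : ContDiffOn ℝ 1 (fun q : (V2 × ℝ) × V2 => (⟪q.1.1, q.2⟫ : ℝ)) subluminal :=
    (contDiff_fst.fst.inner ℝ contDiff_snd).contDiffOn
  have hn : ContDiffOn ℝ 1 (fun q : (V2 × ℝ) × V2 => ‖q.1.1‖ ^ 2) subluminal :=
    (contDiff_fst.fst.norm_sq ℝ).contDiffOn
  have h1 : ContDiffOn ℝ 1 (fun q : (V2 × ℝ) × V2 => q.1.1) subluminal :=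
    contDiff_fst.fst.contDiffOn
  have h2 : ContDiffOn ℝ 1 (fun q : (V2 × ℝ) × V2 => q.2) subluminal := contDiff_snd.contDiffOn
  exact ((hr.smul h1).add (((((hn.sub (hs.pow 2)).mul hs).mul (hr.pow 2)).sub
    (hs.mul hr)).smul h2)).prodMk contDiffOn_const

lemma contDiffOn_spinMomentum : ContDiffOn ℝ 1 spinMomentum subluminal := by
  have hr := contDiffOn_inv_one_sub_inner_sq
  have hs : ContDiffOn ℝ 1 (fun q : (V2 × ℝ) × V2 => (⟪q.1.1, q.2⟫ : ℝ)) subluminal :=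
    (contDiff_fst.fst.inner ℝ contDiff_snd).contDiffOn
  have h1 : ContDiffOn ℝ 1 (fun q : (V2 × ℝ) × V2 => q.1.2) subluminal :=
    contDiff_fst.snd.contDiffOn
  have h2 : ContDiffOn ℝ 1 (fun q : (V2 × ℝ) × V2 => q.2) subluminal := contDiff_snd.contDiffOn
  exact ((((h1.pow 2).mul hs).mul (hr.pow 2)).smul h2).prodMk (h1.mul hr)

/-- The pairing `y ↦ ⟪x.1, y.1⟫ + x.2 * y.2` on `V2 × ℝ`. -/
def pairing (x : V2 × ℝ) : V2 × ℝ →L[ℝ] ℝ :=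
  (innerSL ℝ x.1).comp (ContinuousLinearMap.fst ℝ V2 ℝ) + x.2 • ContinuousLinearMap.snd ℝ V2 ℝ

lemma pairing_apply (x y : V2 × ℝ) : pairing x y = ⟪x.1, y.1⟫ + x.2 * y.2 := rfl

lemma hasDerivAt_inv_one_sub_sq {s σ : ℝ} (hs : s ^ 2 < 1) :
    HasDerivAt (fun t : ℝ => (1 - (s + t * σ) ^ 2)⁻¹)
      (2 * s * σ * ((1 - s ^ 2)⁻¹) ^ 2) 0 := by
  have h1 : HasDerivAt (fun t : ℝ => s + t * σ) σ 0 := by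
    simpa using ((hasDerivAt_id (0 : ℝ)).mul_const σ).const_add s
  have hne : 1 - s ^ 2 ≠ 0 := (sub_pos.2 hs).ne'
  have h2 := ((h1.pow 2).const_sub 1).inv (by simpa using hne)
  refine h2.congr_deriv ?_
  simp
  field_simp

lemma deriv_pairing_chargeMomentum_nonneg (p x : V2 × ℝ) {n : V2} (hn : ‖n‖ = 1)
    (hs : (⟪p.1, n⟫ : ℝ) ^ 2 < 1) :
    0 ≤ deriv (fun t : ℝ => pairing x (chargeMomentum (p + t • x, n))) 0 := by
  obtain ⟨v, ω⟩ := p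
  obtain ⟨u, τ⟩ := x
  set s : ℝ := ⟪v, n⟫ with hsdef
  set σ : ℝ := ⟪u, n⟫ with hσdef
  set c : ℝ := ⟪u, v⟫ with hcdef
  set r : ℝ := (1 - s ^ 2)⁻¹ with hrdef
  have hr : 0 < r := inv_pos.2 (sub_pos.2 hs)
  have hfun : (fun t : ℝ => pairing (u, τ) (chargeMomentum ((v, ω) + t • (u, τ), n))) =
      fun t : ℝ => (1 - (s + t * σ) ^ 2)⁻¹ * (c + t * ‖u‖ ^ 2)
        + ((‖v‖ ^ 2 + 2 * t * c + t ^ 2 * ‖u‖ ^ 2 - (s + t * σ) ^ 2) * (s + t * σ)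
          * ((1 - (s + t * σ) ^ 2)⁻¹) ^ 2 - (s + t * σ) * (1 - (s + t * σ) ^ 2)⁻¹) * σ := by
    funext t
    have h1 : (⟪v + t • u, n⟫ : ℝ) = s + t * σ := by
      rw [inner_add_left, real_inner_smul_left]
    have h2 : ‖v + t • u‖ ^ 2 = ‖v‖ ^ 2 + 2 * t * c + t ^ 2 * ‖u‖ ^ 2 := by
      rw [norm_add_sq_real, real_inner_smul_right, norm_smul, mul_pow, Real.norm_eq_abs, sq_abs,
        real_inner_comm u v]
      ring
    have h3 : (⟪u, v + t • u⟫ : ℝ) = c + t * ‖u‖ ^ 2 := by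
      rw [inner_add_right, real_inner_smul_right, real_inner_self_eq_norm_sq]
    simp only [pairing_apply, chargeMomentum, Prod.fst_add, Prod.smul_fst, h1, h2,
      inner_add_right, real_inner_smul_right u, mul_zero, add_zero]
    rw [← real_inner_smul_right u u t, ← inner_add_right, h3]
  have hlin : ∀ a b : ℝ, HasDerivAt (fun t : ℝ => a + t * b) b 0 := fun a b => by
    simpa using ((hasDerivAt_id (0 : ℝ)).mul_const b).const_add a
  have hN : HasDerivAt (fun t : ℝ => ‖v‖ ^ 2 + 2 * t * c + t ^ 2 * ‖u‖ ^ 2) (2 * c) 0 := by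
    have h1 := ((((hasDerivAt_id (0 : ℝ)).const_mul 2).mul_const c).const_add (‖v‖ ^ 2)).add
      (((hasDerivAt_id (0 : ℝ)).pow 2).mul_const (‖u‖ ^ 2))
    refine (h1.congr_deriv (by simp)).congr_of_eventuallyEq (Eventually.of_forall fun t => ?_)
    simp
  have hrd := hasDerivAt_inv_one_sub_sq (σ := σ) hs
  have hd := (hrd.mul (hlin c (‖u‖ ^ 2))).add
    (((((hN.sub ((hlin s σ).pow 2)).mul (hlin s σ)).mul (hrd.pow 2)).sub
      ((hlin s σ).mul hrd)).mul_const σ)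
  have hU : ‖(u - σ • n) + (2 * s * σ * r) • (v - s • n)‖ ^ 2 =
      (‖u‖ ^ 2 - σ ^ 2) + 4 * s * σ * r * (c - s * σ)
        + 4 * s ^ 2 * σ ^ 2 * r ^ 2 * (‖v‖ ^ 2 - s ^ 2) := by
    simp only [← real_inner_self_eq_norm_sq, inner_add_left, inner_add_right, inner_sub_left,
      inner_sub_right, real_inner_smul_left, real_inner_smul_right]
    rw [real_inner_self_eq_norm_sq n, hn, real_inner_comm u n, real_inner_comm v n,
      real_inner_comm u v, ← hsdef, ← hσdef, ← hcdef]
    ring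
  have hT : 0 ≤ ‖v‖ ^ 2 - s ^ 2 := by
    have h1 : |s| ≤ ‖v‖ * ‖n‖ := abs_real_inner_le_norm v n
    rw [hn, mul_one] at h1
    have := sq_le_sq' (neg_le_of_abs_le h1) (le_of_abs_le h1)
    linarith
  have hgoal : 0 ≤ r * ‖(u - σ • n) + (2 * s * σ * r) • (v - s • n)‖ ^ 2
      + (‖v‖ ^ 2 - s ^ 2) * σ ^ 2 * r ^ 2 := by positivity
  rw [hfun]
  refine hgoal.trans_eq (Eq.trans ?_ hd.deriv.symm)
  rw [hU]
  simp [← hrdef]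
  ring

lemma deriv_pairing_spinMomentum_nonneg (p x : V2 × ℝ) {n : V2}
    (hs : (⟪p.1, n⟫ : ℝ) ^ 2 < 1) :
    0 ≤ deriv (fun t : ℝ => pairing x (spinMomentum (p + t • x, n))) 0 := by
  obtain ⟨v, ω⟩ := p
  obtain ⟨u, τ⟩ := x
  set s : ℝ := ⟪v, n⟫ with hsdef
  set σ : ℝ := ⟪u, n⟫ with hσdef
  set r : ℝ := (1 - s ^ 2)⁻¹ with hrdef
  have hr : 0 < r := inv_pos.2 (sub_pos.2 hs)
  have hr1 : r * (1 - s ^ 2) = 1 := inv_mul_cancel₀ (sub_pos.2 hs).ne'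
  have hfun : (fun t : ℝ => pairing (u, τ) (spinMomentum ((v, ω) + t • (u, τ), n))) =
      fun t : ℝ => (ω + t * τ) ^ 2 * (s + t * σ) * ((1 - (s + t * σ) ^ 2)⁻¹) ^ 2 * σ
        + τ * ((ω + t * τ) * (1 - (s + t * σ) ^ 2)⁻¹) := by
    funext t
    have h1 : (⟪v + t • u, n⟫ : ℝ) = s + t * σ := by
      rw [inner_add_left, real_inner_smul_left]
    simp only [pairing_apply, spinMomentum, Prod.fst_add, Prod.smul_fst, Prod.snd_add,
      Prod.smul_snd, h1, real_inner_smul_right u, smul_eq_mul, ← hσdef]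
  have hlin : ∀ a b : ℝ, HasDerivAt (fun t : ℝ => a + t * b) b 0 := fun a b => by
    simpa using ((hasDerivAt_id (0 : ℝ)).mul_const b).const_add a
  have hrd := hasDerivAt_inv_one_sub_sq (σ := σ) hs
  have hd := (((((hlin ω τ).pow 2).mul (hlin s σ)).mul (hrd.pow 2)).mul_const σ).add
    (((hlin ω τ).mul hrd).const_mul τ)
  have hgoal : 0 ≤ r * (τ + 2 * ω * s * σ * r) ^ 2 + ω ^ 2 * σ ^ 2 * r ^ 2 := by positivity
  rw [hfun]
  refine hgoal.trans_eq (Eq.trans ?_ hd.deriv.symm)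
  simp [← hrdef]
  ring

/-- The unit vector `k / |k|` (zero at `k = 0`). -/
def direction (k : V2) : V2 := ‖k‖⁻¹ • k

lemma norm_direction {k : V2} (hk : k ≠ 0) : ‖direction k‖ = 1 :=
  norm_smul_inv_norm (𝕜 := ℝ) hk

lemma norm_direction_le (k : V2) : ‖direction k‖ ≤ 1 := by
  rcases eq_or_ne k 0 with rfl | hk
  · simp [direction]
  · exact (norm_direction hk).le

lemma measurable_direction : Measurable direction := by
  unfold direction
  fun_prop

lemma Dv_eq (v k : V2) : Dv v k = ‖k‖ ^ 2 * (1 - (⟪v, direction k⟫ : ℝ) ^ 2) := by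
  rcases eq_or_ne k 0 with rfl | hk
  · simp [Dv]
  · rw [Dv, direction, real_inner_smul_right]
    have := norm_ne_zero_iff.2 hk
    field_simp

lemma inner_eq_norm_mul_inner_direction (v k : V2) :
    (⟪v, k⟫ : ℝ) = ‖k‖ * ⟪v, direction k⟫ := by
  rcases eq_or_ne k 0 with rfl | hk
  · simp
  · rw [direction, real_inner_smul_right, mul_inv_cancel_left₀ (norm_ne_zero_iff.2 hk)]

lemma apply_eq_norm_mul_direction (k : V2) (j : Fin 2) : k j = ‖k‖ * direction k j := by
  rcases eq_or_ne k 0 with rfl | hk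
  · simp
  · rw [direction, PiLp.smul_apply, smul_eq_mul, mul_inv_cancel_left₀ (norm_ne_zero_iff.2 hk)]

lemma continuousOn_inv_one_sub_inner_sq {v : V2} (hv : ‖v‖ < 1) :
    ContinuousOn (fun y : V2 => (1 - (⟪v, y⟫ : ℝ) ^ 2)⁻¹) (closedBall 0 1) :=
  ContinuousOn.inv₀ (by fun_prop) fun _ hy =>
    (sub_pos.2 (inner_sq_lt_one hv (mem_closedBall_zero_iff.1 hy))).ne'

lemma integrable_mul_comp_direction {w : V2 → ℝ} (hw : Integrable w) {h : V2 → ℝ}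
    (hh : ContinuousOn h (closedBall 0 1)) : Integrable fun k => w k * h (direction k) :=
  integrable_smul_comp_of_continuousOn hw measurable_direction norm_direction_le hh

lemma slice_mem_subluminal {v : V2} {ω : ℝ} (hv : ‖v‖ < 1) :
    ∀ y ∈ closedBall (0 : V2) 1, ((v, ω), y) ∈ subluminal :=
  fun _ hy => inner_sq_lt_one hv (mem_closedBall_zero_iff.1 hy)

lemma integrable_smul_momentum {v : V2} {ω : ℝ} {w : V2 → ℝ} (hw : Integrable w)
    (hv : ‖v‖ < 1) {φ : (V2 × ℝ) × V2 → V2 × ℝ} (hφ : ContDiffOn ℝ 1 φ subluminal) :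
    Integrable fun k => w k • φ ((v, ω), direction k) :=
  integrable_smul_comp_of_continuousOn hw measurable_direction norm_direction_le
    (h := fun y => φ ((v, ω), y)) (hφ.continuousOn.comp (by fun_prop) (slice_mem_subluminal hv))

lemma Mform_eq {ρ : V2 → ℝ} (hw : Integrable fun k => ‖FT ρ k‖ ^ 2 / ‖k‖ ^ 2)
    (hw' : Integrable fun k => gradNormSqC (FT ρ) k / ‖k‖ ^ 2) (I : ℝ) {v : V2} (hv : ‖v‖ < 1)
    (ω : ℝ) :
    Mform ρ I v ω = I * ω
      + (∫ k, (‖FT ρ k‖ ^ 2 / ‖k‖ ^ 2) • chargeMomentum ((v, ω), direction k)).2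
      + (∫ k, (gradNormSqC (FT ρ) k / ‖k‖ ^ 2) • spinMomentum ((v, ω), direction k)).2 := by
  rw [snd_integral (integrable_smul_momentum hw hv contDiffOn_chargeMomentum),
    snd_integral (integrable_smul_momentum hw' hv contDiffOn_spinMomentum)]
  simp only [chargeMomentum, spinMomentum, Prod.smul_snd, smul_zero, integral_zero, Mform]
  rw [mul_add, ← integral_const_mul]
  congr 1
  · ring
  · refine integral_congr_ae (Eventually.of_forall fun k => ?_)
    simp only [smul_eq_mul, Dv_eq, div_eq_mul_inv, mul_inv]
    ring

lemma Pform_eq {ρ : V2 → ℝ} (hw : Integrable fun k => ‖FT ρ k‖ ^ 2 / ‖k‖ ^ 2)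
    (hw' : Integrable fun k => gradNormSqC (FT ρ) k / ‖k‖ ^ 2) (m : ℝ) {v : V2} (hv : ‖v‖ < 1)
    (ω : ℝ) (j : Fin 2) :
    Pform ρ m v ω j = m * v j
      + (∫ k, (‖FT ρ k‖ ^ 2 / ‖k‖ ^ 2) • chargeMomentum ((v, ω), direction k)).1 j
      + (∫ k, (gradNormSqC (FT ρ) k / ‖k‖ ^ 2) • spinMomentum ((v, ω), direction k)).1 j := by
  let l : V2 × ℝ →L[ℝ] ℝ :=
    (EuclideanSpace.proj j : V2 →L[ℝ] ℝ).comp (ContinuousLinearMap.fst ℝ V2 ℝ)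
  have hl : ∀ x : V2 × ℝ, x.1 j = l x := fun _ => rfl
  have hr := continuousOn_inv_one_sub_inner_sq hv
  rw [hl, hl, ← l.integral_comp_comm (integrable_smul_momentum hw hv contDiffOn_chargeMomentum),
    ← l.integral_comp_comm (integrable_smul_momentum hw' hv contDiffOn_spinMomentum)]
  have i₁ := (integrable_mul_comp_direction hw hr).const_mul (v j)
  have i₂ := integrable_mul_comp_direction hw
    (h := fun y => ⟪v, y⟫ * y j * (1 - (⟪v, y⟫ : ℝ) ^ 2)⁻¹) (by fun_prop)
  have i₃ := integrable_mul_comp_direction hw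
    (h := fun y => (‖v‖ ^ 2 - (⟪v, y⟫ : ℝ) ^ 2) * ⟪v, y⟫ * y j
      * ((1 - (⟪v, y⟫ : ℝ) ^ 2)⁻¹) ^ 2) (by fun_prop)
  have e₁ : ∫ k, l ((‖FT ρ k‖ ^ 2 / ‖k‖ ^ 2) • chargeMomentum ((v, ω), direction k)) =
      v j * (∫ k : V2, ‖FT ρ k‖ ^ 2 / Dv v k)
      - (∫ k : V2, (⟪v, k⟫ : ℝ) * k j * ‖FT ρ k‖ ^ 2 / (‖k‖ ^ 2 * Dv v k))
      + (∫ k : V2, (‖v‖ ^ 2 - (⟪v, k⟫ : ℝ) ^ 2 / ‖k‖ ^ 2) * (⟪v, k⟫ : ℝ) * k j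
          * ‖FT ρ k‖ ^ 2 / (Dv v k) ^ 2) := by
    have c₁ : ∀ k, ‖FT ρ k‖ ^ 2 / Dv v k
        = ‖FT ρ k‖ ^ 2 / ‖k‖ ^ 2 * (1 - (⟪v, direction k⟫ : ℝ) ^ 2)⁻¹ := fun k => by
      rw [Dv_eq, div_mul_eq_div_div, div_eq_mul_inv (_ / _)]
    have c₂ : ∀ k, (⟪v, k⟫ : ℝ) * k j * ‖FT ρ k‖ ^ 2 / (‖k‖ ^ 2 * Dv v k)
        = ‖FT ρ k‖ ^ 2 / ‖k‖ ^ 2 * (⟪v, direction k⟫ * direction k j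
          * (1 - (⟪v, direction k⟫ : ℝ) ^ 2)⁻¹) := fun k => by
      rcases eq_or_ne k 0 with rfl | hk
      · simp
      have h1 := norm_ne_zero_iff.2 hk
      have h2 := (sub_pos.2 (inner_sq_lt_one hv (norm_direction_le k))).ne'
      rw [Dv_eq, inner_eq_norm_mul_inner_direction v k, apply_eq_norm_mul_direction k j]
      field_simp
    have c₃ : ∀ k, (‖v‖ ^ 2 - (⟪v, k⟫ : ℝ) ^ 2 / ‖k‖ ^ 2) * (⟪v, k⟫ : ℝ) * k j
          * ‖FT ρ k‖ ^ 2 / (Dv v k) ^ 2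
        = ‖FT ρ k‖ ^ 2 / ‖k‖ ^ 2 * ((‖v‖ ^ 2 - (⟪v, direction k⟫ : ℝ) ^ 2)
          * ⟪v, direction k⟫ * direction k j
          * ((1 - (⟪v, direction k⟫ : ℝ) ^ 2)⁻¹) ^ 2) := fun k => by
      rcases eq_or_ne k 0 with rfl | hk
      · simp
      have h1 := norm_ne_zero_iff.2 hk
      have h2 := (sub_pos.2 (inner_sq_lt_one hv (norm_direction_le k))).ne'
      rw [Dv_eq, inner_eq_norm_mul_inner_direction v k, apply_eq_norm_mul_direction k j]
      field_simp
    simp_rw [c₁, c₂, c₃]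
    rw [← integral_const_mul, ← integral_sub i₁ i₂]
    refine Eq.trans ?_ (integral_add (i₁.sub i₂) i₃)
    refine integral_congr_ae (Eventually.of_forall fun k => ?_)
    simp only [← hl, chargeMomentum, Prod.smul_fst, PiLp.smul_apply, PiLp.add_apply, smul_eq_mul]
    ring
  have e₂ : ∫ k, l ((gradNormSqC (FT ρ) k / ‖k‖ ^ 2) • spinMomentum ((v, ω), direction k)) =
      ω ^ 2 * (∫ k : V2, (⟪v, k⟫ : ℝ) * k j * gradNormSqC (FT ρ) k / (Dv v k) ^ 2) := by
    rw [← integral_const_mul]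
    refine integral_congr_ae (Eventually.of_forall fun k => ?_)
    simp only [← hl, spinMomentum, Prod.smul_fst, PiLp.smul_apply, smul_eq_mul]
    rcases eq_or_ne k 0 with rfl | hk
    · simp
    have h1 := norm_ne_zero_iff.2 hk
    have h2 := (sub_pos.2 (inner_sq_lt_one hv (norm_direction_le k))).ne'
    rw [Dv_eq, inner_eq_norm_mul_inner_direction v k, apply_eq_norm_mul_direction k j]
    field_simp
  rw [e₁, e₂, Pform]
  ring

/-- The diagonal map `(v, ω) ↦ (m v, I ω)`. -/
def mechanicalMomentum (m I : ℝ) : V2 × ℝ →L[ℝ] V2 × ℝ :=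
  (m • ContinuousLinearMap.id ℝ V2).prodMap (I • ContinuousLinearMap.id ℝ ℝ)

lemma Fmap_eq {ρ : V2 → ℝ} (hw : Integrable fun k => ‖FT ρ k‖ ^ 2 / ‖k‖ ^ 2)
    (hw' : Integrable fun k => gradNormSqC (FT ρ) k / ‖k‖ ^ 2) (m I : ℝ) {p : V2 × ℝ}
    (hp : ‖p.1‖ < 1) :
    Fmap ρ m I p = mechanicalMomentum m I p
      + (∫ k, (‖FT ρ k‖ ^ 2 / ‖k‖ ^ 2) • chargeMomentum (p, direction k))
      + ∫ k, (gradNormSqC (FT ρ) k / ‖k‖ ^ 2) • spinMomentum (p, direction k) := by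
  refine Prod.ext ?_ (Mform_eq hw hw' I hp p.2)
  ext j
  exact Pform_eq hw hw' m hp p.2 j

lemma pairing_mechanicalMomentum_pos {m I : ℝ} (hm : 0 < m) (hI : 0 < I) {x : V2 × ℝ}
    (hx : x ≠ 0) : 0 < pairing x (mechanicalMomentum m I x) := by
  have h : pairing x (mechanicalMomentum m I x) = m * ‖x.1‖ ^ 2 + I * x.2 ^ 2 := by
    change (⟪x.1, m • x.1⟫ : ℝ) + x.2 * (I * x.2) = _
    rw [real_inner_smul_right, real_inner_self_eq_norm_sq]
    ring
  rw [h]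
  by_cases h1 : x.1 = 0
  · have h2 : x.2 ≠ 0 := fun h2 => hx (Prod.ext h1 h2)
    positivity
  · have := norm_pos_iff.2 h1
    positivity

/-- the momentum map `F(v,ω) = (P(v,ω), M(v,ω))` is differentiable on
`Σ = {|v| < 1}` and its Jacobian determinant `det ∂(P,M)/∂(v,ω)` is strictly positive
there; in particular it never vanishes. -/
theorem jacobian_positive
    (ρ : SchwartzMap V2 ℝ)
    (hrad : ∀ x y : V2, ‖x‖ = ‖y‖ → ρ x = ρ y)
    (hneu : (∫ x : V2, ρ x) = 0)
    (m I : ℝ) (hm : 0 < m) (hI : 0 < I) :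
    ∀ (v : V2) (ω : ℝ), ‖v‖ < 1 →
      DifferentiableAt ℝ (Fmap (⇑ρ) m I) (v, ω)
      ∧ 0 < LinearMap.det
          ((fderiv ℝ (Fmap (⇑ρ) m I) (v, ω)) : (V2 × ℝ) →ₗ[ℝ] (V2 × ℝ)) := by
  intro v ω hv
  have heven : ∀ x, ρ (-x) = ρ x := fun x => hrad _ _ (norm_neg x)
  have hw := integrable_FT_weight ρ hneu
  have hw' := integrable_gradNormSqC_weight ρ heven
  have hgrad : ∀ k, 0 ≤ gradNormSqC (FT ρ) k := fun k =>
    Finset.sum_nonneg fun _ _ => by positivity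
  obtain ⟨L₁, hL₁, hpos₁⟩ := exists_hasFDerivAt_integral_smul hw (fun k => by positivity)
    measurable_direction norm_direction_le isOpen_subluminal contDiffOn_chargeMomentum
    (p₀ := (v, ω)) (slice_mem_subluminal hv)
  obtain ⟨L₂, hL₂, hpos₂⟩ := exists_hasFDerivAt_integral_smul hw'
    (fun k => div_nonneg (hgrad k) (by positivity))
    measurable_direction norm_direction_le isOpen_subluminal contDiffOn_spinMomentum
    (p₀ := (v, ω)) (slice_mem_subluminal hv)
  have hnhds : ∀ᶠ p : V2 × ℝ in 𝓝 (v, ω), ‖p.1‖ < 1 :=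
    (isOpen_lt (by fun_prop) continuous_const).mem_nhds hv
  have hF : HasFDerivAt (Fmap ρ m I) (mechanicalMomentum m I + L₁ + L₂) (v, ω) :=
    (((mechanicalMomentum m I).hasFDerivAt.add hL₁).add hL₂).congr_of_eventuallyEq
      (hnhds.mono fun p hp => Fmap_eq hw hw' m I hp)
  refine ⟨hF.differentiableAt, ?_⟩
  rw [hF.fderiv]
  refine det_pos_of_pairing_pos _ (fun x => (pairing x : V2 × ℝ →ₗ[ℝ] ℝ)) ?_ ?_
  · intro x hx
    simpa [mechanicalMomentum] using pairing_mechanicalMomentum_pos one_pos one_pos hx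
  · intro x hx
    have h₀ := pairing_mechanicalMomentum_pos hm hI hx
    have h₁ := hpos₁ x (pairing x) fun k hk =>
      deriv_pairing_chargeMomentum_nonneg (v, ω) x
        (norm_direction fun h => hk (by simp [h]))
        (inner_sq_lt_one hv (norm_direction_le k))
    have h₂ := hpos₂ x (pairing x) fun k _ =>
      deriv_pairing_spinMomentum_nonneg (v, ω) x (inner_sq_lt_one hv (norm_direction_le k))
    change 0 < pairing x (mechanicalMomentum m I x + L₁ x + L₂ x)
    rw [map_add, map_add]
    linarith

end
end
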